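/- For a Nakayama algebra Λ, the finitistic dimension of Λ, the finitistic dimension of the opposite algebra Λ^op, the delooping level of Λ, and the delooping level of Λ^op are all equal. -/

import Mathlib

open Function DirectSum
open scoped Classical

noncomputable section

section Preamble

variable (A : Type) [Ring A]

/-- A submodule is small (superfluous) if it has no proper supplement. -/
def IsSmallSubmodule {M : Type} [AddCommGroup M] [Module A M] (N : Submodule A M) : Prop :=
  ∀ K : Submodule A M, N ⊔ K = ⊤ → K = ⊤

/-- `P` is a projective cover of `M`: `P` is projective, finitely generated, and there is a
surjection `P → M` with small (superfluous) kernel. -/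
def IsProjCoverOf (P M : ModuleCat.{0} A) : Prop :=
  Module.Projective A ↥P ∧ Module.Finite A ↥P ∧
    ∃ f : ↥P →ₗ[A] ↥M, Function.Surjective f ∧ IsSmallSubmodule A (LinearMap.ker f)

/-- `N` is (isomorphic to) the syzygy `Ω(M)`, i.e. the kernel of a projective cover of `M`. -/
def IsSyzygyOf (N M : ModuleCat.{0} A) : Prop :=
  ∃ (P : ModuleCat.{0} A) (f : ↥P →ₗ[A] ↥M),
    Module.Projective A ↥P ∧ Module.Finite A ↥P ∧ Function.Surjective f ∧
      IsSmallSubmodule A (LinearMap.ker f) ∧ Nonempty (↥N ≃ₗ[A] ↥(LinearMap.ker f))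

/-- `N` is (isomorphic to) the `n`-th syzygy `Ω^n(M)`. -/
def IsNthSyzygyOf : ℕ → ModuleCat.{0} A → ModuleCat.{0} A → Prop
  | 0 => fun N M => Nonempty (↥N ≃ₗ[A] ↥M)
  | n + 1 => fun N M => ∃ K : ModuleCat.{0} A, IsNthSyzygyOf n K M ∧ IsSyzygyOf A N K

/-- An indecomposable module: nontrivial, with no nontrivial direct sum decomposition. -/
def IndecomposableModule (M : ModuleCat.{0} A) : Prop :=
  Nontrivial ↥M ∧ ∀ N N' : Submodule A ↥M, IsCompl N N' → N = ⊥ ∨ N = ⊤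

/-- A uniserial module: the submodules form a chain. -/
def IsUniserialModule (M : ModuleCat.{0} A) : Prop :=
  ∀ N N' : Submodule A ↥M, N ≤ N' ∨ N' ≤ N

/-- A (one-sided) Nakayama condition: an Artinian ring all of whose finitely generated
indecomposable modules are uniserial. -/
def IsNakayamaRing : Prop :=
  IsArtinianRing A ∧
    ∀ M : ModuleCat.{0} A, Module.Finite A ↥M → IndecomposableModule A M → IsUniserialModule A M

/-- A Nakayama algebra: all indecomposable finitely generated (left and right) modules
are uniserial. -/
def IsNakayamaAlgebra : Prop := IsNakayamaRing A ∧ IsNakayamaRing Aᵐᵒᵖ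

/-- Connectedness: the only central idempotents are `0` and `1`. -/
def IsConnectedRing : Prop :=
  ∀ e : A, IsIdempotentElem e → e ∈ Set.center A → e = 0 ∨ e = 1

/-- A cyclic Nakayama algebra: a connected Nakayama algebra whose quiver is a cyclically
oriented cycle, equivalently with no simple projective module. -/
def IsCyclicNakayama : Prop :=
  IsNakayamaAlgebra A ∧ IsConnectedRing A ∧
    ∀ M : ModuleCat.{0} A, IsSimpleModule A ↥M → ¬ Module.Projective A ↥M

/-- The projective dimension of a module, computed via minimal projective resolutions:
the least `n` such that `Ω^n(M)` is projective (`⊤ = ∞` if there is none). -/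
def projDim (M : ModuleCat.{0} A) : ℕ∞ :=
  sInf ((fun n : ℕ => (n : ℕ∞)) ''
    {n : ℕ | ∃ N : ModuleCat.{0} A, IsNthSyzygyOf A n N M ∧ Module.Projective A ↥N})

/-- The finitistic dimension: the supremum of the (finite) projective dimensions of
finitely generated modules of finite projective dimension. -/
def finDim : ℕ∞ :=
  sSup {d : ℕ∞ | d ≠ ⊤ ∧ ∃ M : ModuleCat.{0} A, Module.Finite A ↥M ∧ projDim A M = d}

/-- The global dimension: the supremum of the projective dimensions of all finitely
generated modules. -/
def globalDim : ℕ∞ :=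
  sSup {d : ℕ∞ | ∃ M : ModuleCat.{0} A, Module.Finite A ↥M ∧ projDim A M = d}

/-- `N` is a direct summand of `M`. -/
def IsDirectSummandOf (N M : ModuleCat.{0} A) : Prop :=
  ∃ C : ModuleCat.{0} A, Nonempty (↥M ≃ₗ[A] (↥N × ↥C))

/-- The delooping level of a module `M`:
`del M = min { d | Ω^d(M) is a direct summand of A ⊕ Ω^{d+1}(M') for some f.g. M' }`. -/
def delMod (M : ModuleCat.{0} A) : ℕ∞ :=
  sInf ((fun n : ℕ => (n : ℕ∞)) ''
    {d : ℕ | ∃ (M' N N' : ModuleCat.{0} A), Module.Finite A ↥M' ∧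
      IsNthSyzygyOf A d N M ∧ IsNthSyzygyOf A (d + 1) N' M' ∧
      IsDirectSummandOf A N (ModuleCat.of A (A × ↥N'))})

/-- The delooping level of the algebra: the supremum over simple modules. -/
def delAlg : ℕ∞ :=
  sSup {d : ℕ∞ | ∃ S : ModuleCat.{0} A, IsSimpleModule A ↥S ∧ delMod A S = d}

/-- A periodic module: `Ω^t(M) ≅ M` for some `t ≥ 1`. -/
def IsPeriodicModule (M : ModuleCat.{0} A) : Prop :=
  ∃ t : ℕ, 1 ≤ t ∧ IsNthSyzygyOf A t M M

/-- Selfinjectivity: the regular module is injective. -/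
def IsSelfinjectiveRing : Prop := Module.Injective A A

/-- The socle of a module: the sum of all simple submodules. -/
def socleOf (M : ModuleCat.{0} A) : Submodule A ↥M :=
  sSup {N : Submodule A ↥M | IsSimpleModule A ↥N}

/-- The radical of a module: `rad M = J(A)·M`. -/
def radOf (M : Type) [AddCommGroup M] [Module A M] : Submodule A M :=
  (Ideal.jacobson (⊥ : Ideal A)) • (⊤ : Submodule A M)

/-- The top of a module: `M / rad M`. -/
abbrev topOf (M : Type) [AddCommGroup M] [Module A M] :=
  M ⧸ radOf A M

end Preamble

section Phi

variable (A : Type) [Ring A]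

/-- Finitely generated indecomposable modules. -/
def FGIndec := {M : ModuleCat.{0} A // Module.Finite A ↥M ∧ IndecomposableModule A M}

/-- Isomorphism as a setoid on finitely generated indecomposable modules. -/
def indecSetoid : Setoid (FGIndec A) where
  r X Y := Nonempty (↥X.1 ≃ₗ[A] ↥Y.1)
  iseqv := ⟨fun _ => ⟨LinearEquiv.refl A _⟩,
            fun h => h.elim fun e => ⟨e.symm⟩,
            fun h h' => h.elim fun e => h'.elim fun e' => ⟨e.trans e'⟩⟩

/-- Isomorphism classes of finitely generated indecomposable modules. -/
abbrev IndecIso := Quotient (indecSetoid A)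

/-- The free abelian group on iso-classes of f.g. indecomposable modules. -/
abbrev K0Group := IndecIso A →₀ ℤ

/-- `f` records a decomposition of `M` as a direct sum of indecomposables with
multiplicities. -/
def IsDecompositionOf (f : IndecIso A →₀ ℕ) (M : ModuleCat.{0} A) : Prop :=
  Nonempty (↥M ≃ₗ[A] DirectSum (Σ x : f.support, Fin (f x.1))
    (fun i => ↥((Quotient.out i.1.1).1)))

/-- The class of `M` in the free abelian group on indecomposables (junk value `0` if no
decomposition exists). -/
def decompClass (M : ModuleCat.{0} A) : K0Group A :=
  if h : ∃ f : IndecIso A →₀ ℕ, IsDecompositionOf A f M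
  then (Classical.choose h).mapRange (fun m : ℕ => (m : ℤ)) (by simp)
  else 0

/-- A choice of syzygy module `Ω(M)` (junk value `0` if no projective cover exists). -/
def syzygyModule (M : ModuleCat.{0} A) : ModuleCat.{0} A :=
  if h : ∃ N : ModuleCat.{0} A, IsSyzygyOf A N M then Classical.choose h
  else ModuleCat.of A PUnit

/-- The Igusa–Todorov endomorphism `L` of the free abelian group on indecomposables,
sending `[M] ↦ [Ω M]`. -/
def syzygyEnd : AddMonoid.End (K0Group A) :=
  Finsupp.liftAddHom fun x : IndecIso A =>
    (zmultiplesHom (K0Group A)) (decompClass A (syzygyModule A (Quotient.out x).1))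

/-- The generators `[X]`, `X` an indecomposable direct summand of `M`, of the subgroup
`⟨add M⟩`. -/
def addGenerators (M : ModuleCat.{0} A) : Set (K0Group A) :=
  {g | ∃ (X : ModuleCat.{0} A) (h : Module.Finite A ↥X ∧ IndecomposableModule A X),
      IsDirectSummandOf A X M ∧ g = Finsupp.single (Quotient.mk (indecSetoid A) ⟨X, h⟩) 1}

/-- The Igusa–Todorov function `φ(M)`: the least `t` at which the rank of
`L^t⟨add M⟩` stabilizes. -/
def phiMod (M : ModuleCat.{0} A) : ℕ∞ :=
  sInf ((fun n : ℕ => (n : ℕ∞)) ''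
    {t : ℕ | ∀ j : ℕ, 1 ≤ j →
      Module.finrank ℤ
        ↥(AddSubgroup.map ((syzygyEnd A) ^ t) (AddSubgroup.closure (addGenerators A M))) =
      Module.finrank ℤ
        ↥(AddSubgroup.map ((syzygyEnd A) ^ (t + j)) (AddSubgroup.closure (addGenerators A M)))})

/-- The `φ`-dimension of the algebra. -/
def phiDim : ℕ∞ :=
  sSup {d : ℕ∞ | ∃ M : ModuleCat.{0} A, Module.Finite A ↥M ∧ phiMod A M = d}

end Phi

section Epsilon

variable (A : Type) [Ring A]

/-- `T` is (isomorphic to) the socle of some indecomposable projective module. -/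
def IsSocleOfIndecProjective (T : ModuleCat.{0} A) : Prop :=
  IsSimpleModule A ↥T ∧ ∃ Q : ModuleCat.{0} A, Module.Projective A ↥Q ∧ Module.Finite A ↥Q ∧
    IndecomposableModule A Q ∧ Nonempty (↥T ≃ₗ[A] ↥(socleOf A Q))

/-- `S` belongs to `S'(Λ)`: `S ≅ S_{i+1}` where `S_i` is a socle of an indecomposable
projective; here `S_{i+1} = top (rad P(S_i))` for the cyclic quiver. -/
def IsInSPrime (S : ModuleCat.{0} A) : Prop :=
  IsSimpleModule A ↥S ∧ ∃ T P : ModuleCat.{0} A, IsSocleOfIndecProjective A T ∧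
    IsProjCoverOf A P T ∧ Nonempty ((topOf A ↥(radOf A ↥P)) ≃ₗ[A] ↥S)

/-- `B` is (isomorphic to) the syzygy filtered algebra
`ε(Λ) = End_Λ(⊕_{S ∈ S'(Λ)} P(S))`. -/
def IsSyzygyFilteredAlgebra (B : Type) [Ring B] : Prop :=
  ∃ (ι : Type) (_ : Fintype ι) (Sf Pf : ι → ModuleCat.{0} A),
    (∀ i, IsInSPrime A (Sf i) ∧ IsProjCoverOf A (Pf i) (Sf i)) ∧
    (∀ i j, Nonempty (↥(Sf i) ≃ₗ[A] ↥(Sf j)) → i = j) ∧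
    (∀ S : ModuleCat.{0} A, IsInSPrime A S → ∃ i, Nonempty (↥S ≃ₗ[A] ↥(Sf i))) ∧
    Nonempty (B ≃+* Module.End A (DirectSum ι fun i => ↥(Pf i)))

/-- `B` is (isomorphic to) the `d`-th iterated syzygy filtered algebra `ε^d(Λ)`,
each intermediate step being a cyclic non-selfinjective Nakayama algebra. -/
def IsIterSyzygyFiltered (d : ℕ) (B : Type) [Ring B] : Prop :=
  ∃ C : ℕ → RingCat.{0},
    Nonempty (A ≃+* ↥(C 0)) ∧ Nonempty (↥(C d) ≃+* B) ∧
    ∀ i < d, IsCyclicNakayama ↥(C i) ∧ ¬ IsSelfinjectiveRing ↥(C i) ∧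
      IsSyzygyFilteredAlgebra ↥(C i) ↥(C (i + 1))

end Epsilon


namespace Nakayama

section Ext

open CategoryTheory Abelian

variable {B : Type} [Ring B]

/-- Vanishing of `Ext^n_B(M, Y)`. -/
abbrev ExtVanishes (n : ℕ) (M Y : ModuleCat.{0} B) : Prop := Subsingleton (Ext M Y n)

/-- The short complex of modules attached to an exact pair of linear maps. -/
def shortComplexOfExact {K P M : ModuleCat.{0} B} (i : K →ₗ[B] P) (p : P →ₗ[B] M)
    (h : Function.Exact i p) : ShortComplex (ModuleCat.{0} B) :=
  ShortComplex.mk (ModuleCat.ofHom i) (ModuleCat.ofHom p) (by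
    rw [← ModuleCat.ofHom_comp, h.linearMap_comp_eq_zero]; rfl)

theorem shortExact_shortComplexOfExact {K P M : ModuleCat.{0} B} (i : K →ₗ[B] P) (p : P →ₗ[B] M)
    (h : Function.Exact i p) (hi : Injective i) (hp : Surjective p) :
    (shortComplexOfExact i p h).ShortExact :=
  ModuleCat.shortComplex_shortExact _ h hi hp

theorem extVanishes_shift_left {K P M : ModuleCat.{0} B} {i : K →ₗ[B] P} {p : P →ₗ[B] M}
    (h : Function.Exact i p) (hi : Injective i) (hp : Surjective p) [Module.Projective B P]
    (Y : ModuleCat.{0} B) (n : ℕ) :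
    ExtVanishes (n + 1) K Y ↔ ExtVanishes (n + 2) M Y := by
  have hS := shortExact_shortComplexOfExact i p h hi hp
  have hP : Projective (shortComplexOfExact i p h).X₂ :=
    (IsProjective.iff_projective (R := B) P).1 inferInstance
  constructor
  · intro hK
    refine subsingleton_of_forall_eq 0 fun z : Ext M Y (n + 2) => ?_
    obtain ⟨w, hw⟩ := Ext.contravariant_sequence_exact₃ hS Y z
      (Ext.eq_zero_of_projective (P := (shortComplexOfExact i p h).X₂) _)
      (show 1 + (n + 1) = n + 2 by omega)
    rw [← hw, show w = 0 from hK.elim _ _, Ext.comp_zero]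
    rfl
  · intro hM
    refine subsingleton_of_forall_eq 0 fun z : Ext K Y (n + 1) => ?_
    obtain ⟨w, hw⟩ := Ext.contravariant_sequence_exact₁ hS Y z
      (show 1 + (n + 1) = n + 2 by omega) (hM.elim _ _)
    rw [← hw, Ext.eq_zero_of_projective (P := (shortComplexOfExact i p h).X₂) w, Ext.comp_zero]
    rfl

theorem extVanishes_shift_right {Y I Y' : ModuleCat.{0} B} {i : Y →ₗ[B] I} {p : I →ₗ[B] Y'}
    (h : Function.Exact i p) (hi : Injective i) (hp : Surjective p) [Module.Injective B I]
    (M : ModuleCat.{0} B) (n : ℕ) :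
    ExtVanishes (n + 1) M Y' ↔ ExtVanishes (n + 2) M Y := by
  have hS := shortExact_shortComplexOfExact i p h hi hp
  have hI : CategoryTheory.Injective (shortComplexOfExact i p h).X₂ :=
    (Module.injective_iff_injective_object B I).1 inferInstance
  constructor
  · intro hK
    refine subsingleton_of_forall_eq 0 fun z : Ext M Y (n + 2) => ?_
    obtain ⟨w, hw⟩ := Ext.covariant_sequence_exact₁ M hS z
      (Ext.eq_zero_of_injective (I := (shortComplexOfExact i p h).X₂) _)
      (show (n + 1) + 1 = n + 2 by omega)
    rw [← hw, show w = 0 from hK.elim _ _, Ext.zero_comp]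
    rfl
  · intro hM
    refine subsingleton_of_forall_eq 0 fun z : Ext M Y' (n + 1) => ?_
    obtain ⟨w, hw⟩ := Ext.covariant_sequence_exact₃ M hS z
      (show (n + 1) + 1 = n + 2 by omega) (hM.elim _ _)
    rw [← hw, Ext.eq_zero_of_injective (I := (shortComplexOfExact i p h).X₂) w, Ext.zero_comp]
    rfl

theorem extVanishes_of_retract {M Y Z : ModuleCat.{0} B} {n : ℕ} (i : Y →ₗ[B] Z) (r : Z →ₗ[B] Y)
    (h : ∀ y, r (i y) = y) (hZ : ExtVanishes n M Z) : ExtVanishes n M Y := by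
  have hir : ModuleCat.ofHom i ≫ ModuleCat.ofHom r = 𝟙 Y := by
    ext y; exact h y
  refine subsingleton_of_forall_eq 0 fun z : Ext M Y n => ?_
  have hz : (z.comp (Ext.mk₀ (ModuleCat.ofHom i)) (add_zero n)).comp
      (Ext.mk₀ (ModuleCat.ofHom r)) (add_zero n) = z := by
    rw [Ext.comp_assoc_of_third_deg_zero, Ext.mk₀_comp_mk₀, hir, Ext.comp_mk₀_id]
  rw [← hz, hZ.elim (z.comp (Ext.mk₀ (ModuleCat.ofHom i)) (add_zero n)) 0, Ext.zero_comp]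

theorem extVanishes_of_linearEquiv {M N Y : ModuleCat.{0} B} {n : ℕ} (e : M ≃ₗ[B] N)
    (hN : ExtVanishes n N Y) : ExtVanishes n M Y := by
  refine subsingleton_of_forall_eq 0 fun z : Ext M Y n => ?_
  have hz : (Ext.mk₀ e.toModuleIso.hom).comp
      ((Ext.mk₀ e.toModuleIso.inv).comp z (zero_add _)) (zero_add _) = z := by
    rw [Ext.mk₀_comp_mk₀_assoc, e.toModuleIso.hom_inv_id, Ext.mk₀_id_comp]
  rw [← hz, hN.elim ((Ext.mk₀ e.toModuleIso.inv).comp z (zero_add _)) 0, Ext.comp_zero]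

/-- If `Ext^1(M, Y) = 0`, then maps into `Y` extend along the inclusion of a kernel of a
surjection onto `M`. -/
theorem exists_extension_of_extVanishes {K P M Y : ModuleCat.{0} B} {i : K →ₗ[B] P}
    {p : P →ₗ[B] M} (h : Function.Exact i p) (hi : Injective i) (hp : Surjective p)
    (hv : ExtVanishes 1 M Y) (g : K →ₗ[B] Y) : ∃ f : P →ₗ[B] Y, f ∘ₗ i = g := by
  have hS := shortExact_shortComplexOfExact i p h hi hp
  obtain ⟨w, hw⟩ := Ext.contravariant_sequence_exact₁ hS Y
    (Ext.mk₀ (show (shortComplexOfExact i p h).X₁ ⟶ Y from ModuleCat.ofHom g))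
    (show 1 + 0 = 1 by omega) (hv.elim _ _)
  obtain ⟨f, rfl⟩ := (Ext.mk₀_bijective _ _).2 w
  rw [Ext.mk₀_comp_mk₀] at hw
  have := (Ext.mk₀_bijective _ _).1 hw
  exact ⟨f.hom, congrArg ModuleCat.Hom.hom this⟩

end Ext

section Syzygy

variable {B : Type} [Ring B]

theorem exists_exact_of_isSyzygyOf {N M : ModuleCat.{0} B} (h : IsSyzygyOf B N M) :
    ∃ (P : ModuleCat.{0} B) (i : N →ₗ[B] P) (p : P →ₗ[B] M),
      Module.Projective B P ∧ Module.Finite B P ∧ Function.Exact i p ∧ Injective i ∧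
        Surjective p ∧ IsSmallSubmodule B (LinearMap.range i) := by
  obtain ⟨P, f, hP, hF, hf, hs, ⟨e⟩⟩ := h
  have hr : LinearMap.range ((LinearMap.ker f).subtype ∘ₗ e.toLinearMap) = LinearMap.ker f := by
    rw [LinearMap.range_comp, LinearEquiv.range, Submodule.map_top, Submodule.range_subtype]
  refine ⟨P, (LinearMap.ker f).subtype ∘ₗ e.toLinearMap, f, hP, hF, ?_, ?_, hf, ?_⟩
  · rw [LinearMap.exact_iff, hr]
  · exact (Submodule.injective_subtype _).comp e.injective
  · rwa [hr]

theorem extVanishes_nthSyzygy_left {N M : ModuleCat.{0} B} {k : ℕ} (h : IsNthSyzygyOf B k N M)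
    (Y : ModuleCat.{0} B) (n : ℕ) : ExtVanishes (n + 1) N Y ↔ ExtVanishes (n + k + 1) M Y := by
  induction k generalizing N n with
  | zero =>
    obtain ⟨e⟩ := h
    exact ⟨extVanishes_of_linearEquiv e.symm, extVanishes_of_linearEquiv e⟩
  | succ k ih =>
    obtain ⟨K, hK, hN⟩ := h
    obtain ⟨P, i, p, hP, -, hex, hi, hp, -⟩ := exists_exact_of_isSyzygyOf hN
    rw [extVanishes_shift_left hex hi hp Y n, show n + (k + 1) + 1 = (n + 1) + k + 1 by omega,
      ← ih hK (n + 1)]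

end Syzygy

section CharacterDual

variable {A B : Type} [Ring A] [Ring B]

/-- The character dual `Hom_ℤ(X, ℚ/ℤ)` of an `A`-module, as a module over a ring `B` identified
with the opposite of `A`. -/
def CharDual (_ : B ≃+* Aᵐᵒᵖ) (X : Type) [AddCommGroup X] [Module A X] : Type :=
  X →+ AddCircle (1 : ℚ)

namespace CharDual

variable (e : B ≃+* Aᵐᵒᵖ) (X : Type) [AddCommGroup X] [Module A X]

instance : AddCommGroup (CharDual e X) :=
  inferInstanceAs (AddCommGroup (X →+ AddCircle (1 : ℚ)))

instance : FunLike (CharDual e X) X (AddCircle (1 : ℚ)) :=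
  inferInstanceAs (FunLike (X →+ AddCircle (1 : ℚ)) X (AddCircle (1 : ℚ)))

instance : AddMonoidHomClass (CharDual e X) X (AddCircle (1 : ℚ)) :=
  inferInstanceAs (AddMonoidHomClass (X →+ AddCircle (1 : ℚ)) X (AddCircle (1 : ℚ)))

variable {e X}

@[ext] theorem ext {c d : CharDual e X} (h : ∀ x, c x = d x) : c = d := DFunLike.ext _ _ h

@[simp] theorem add_apply (c d : CharDual e X) (x : X) : (c + d) x = c x + d x := rfl

@[simp] theorem zero_apply (x : X) : (0 : CharDual e X) x = 0 := rfl

instance : SMul B (CharDual e X) :=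
  ⟨fun b c => AddMonoidHom.comp (show X →+ AddCircle (1 : ℚ) from c)
    (DistribSMul.toAddMonoidHom X (e b).unop)⟩

@[simp] theorem smul_apply (b : B) (c : CharDual e X) (x : X) :
    (b • c) x = c ((e b).unop • x) := rfl

instance : Module B (CharDual e X) where
  one_smul c := by ext x; simp
  mul_smul a b c := by ext x; simp [mul_smul]
  smul_zero b := by ext x; simp
  smul_add b c d := by ext x; simp
  add_smul a b c := by ext x; simp [add_smul]
  zero_smul c := by ext x; simp

/-- The dual of a linear map. -/
def map {Y : Type} [AddCommGroup Y] [Module A Y] (f : X →ₗ[A] Y) :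
    CharDual e Y →ₗ[B] CharDual e X where
  toFun c := AddMonoidHom.comp (show Y →+ AddCircle (1 : ℚ) from c) f.toAddMonoidHom
  map_add' _ _ := rfl
  map_smul' b c := by
    ext x
    change c ((e b).unop • f x) = c (f ((e b).unop • x))
    rw [f.map_smul]

@[simp] theorem map_apply {Y : Type} [AddCommGroup Y] [Module A Y] (f : X →ₗ[A] Y)
    (c : CharDual e Y) (x : X) : map f c x = c (f x) := rfl

theorem map_injective {Y : Type} [AddCommGroup Y] [Module A Y] {f : X →ₗ[A] Y}
    (hf : Surjective f) : Injective (map (e := e) f) := by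
  intro c d h
  ext y
  obtain ⟨x, rfl⟩ := hf y
  exact DFunLike.congr_fun h x

theorem map_surjective {Y : Type} [AddCommGroup Y] [Module A Y] {f : X →ₗ[A] Y}
    (hf : Injective f) : Surjective (map (e := e) f) :=
  CharacterModule.dual_surjective_of_injective (f.toAddMonoidHom.toIntLinearMap) hf

theorem map_exact {Y Z : Type} [AddCommGroup Y] [Module A Y] [AddCommGroup Z] [Module A Z]
    {f : X →ₗ[A] Y} {g : Y →ₗ[A] Z} (h : Function.Exact f g) (hg : Surjective g) :
    Function.Exact (map (e := e) g) (map (e := e) f) := by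
  intro c
  constructor
  · intro hc
    have hker : g.toAddMonoidHom.ker ≤ AddMonoidHom.ker (show Y →+ AddCircle (1 : ℚ) from c) := by
      intro y hy
      obtain ⟨x, rfl⟩ := (h y).1 hy
      exact DFunLike.congr_fun hc x
    refine ⟨AddMonoidHom.liftOfSurjective g.toAddMonoidHom hg ⟨c, hker⟩, ?_⟩
    ext y
    exact AddMonoidHom.liftOfRightInverse_comp_apply g.toAddMonoidHom _
      (Function.rightInverse_surjInv hg)
      ⟨(show Y →+ AddCircle (1 : ℚ) from c), hker⟩ y
  · rintro ⟨d, rfl⟩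
    ext x
    change d (g (f x)) = 0
    rw [h.apply_apply_eq_zero, map_zero]

instance injective_of_projective [Module.Projective A X] : Module.Injective B (CharDual e X) where
  out U V _ _ _ _ f hf g := by
    obtain ⟨s, hs⟩ := Module.projective_def'.1 ‹Module.Projective A X›
    have hext : ∀ p : X, ∃ h : V →+ AddCircle (1 : ℚ), ∀ u, h (f u) = g u p := fun p => by
      obtain ⟨h, hh⟩ := CharacterModule.dual_surjective_of_injective
        (f.toAddMonoidHom.toIntLinearMap) hf
        (show U →+ AddCircle (1 : ℚ) from
          { toFun := fun u => g u p
            map_zero' := by simp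
            map_add' := by simp })
      exact ⟨h, fun u => DFunLike.congr_fun hh u⟩
    choose h hh using hext
    have hmul : ∀ (b : B) (a : A), e.symm (MulOpposite.op ((e b).unop * a)) =
        e.symm (MulOpposite.op a) * b := fun b a => by
      apply e.injective; simp
    let H : V → CharDual e X := fun v => show X →+ AddCircle (1 : ℚ) from
      { toFun := fun x => (s x).sum fun p a => h p (e.symm (MulOpposite.op a) • v)
        map_zero' := by simp
        map_add' := fun x y => by
          rw [map_add]
          refine Finsupp.sum_add_index' (fun p => ?_) (fun p a b => ?_)
          · simp
          · simp [add_smul] }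
    have hH : ∀ v x, H v x = (s x).sum fun p a => h p (e.symm (MulOpposite.op a) • v) :=
      fun _ _ => rfl
    refine ⟨{ toFun := H
              map_add' := fun v w => by
                ext x
                rw [add_apply, hH, hH, hH, ← Finsupp.sum_add]
                simp
              map_smul' := fun b v => by
                ext x
                rw [RingHom.id_apply, smul_apply, hH, hH, map_smul,
                  Finsupp.sum_smul_index (by simp)]
                simp only [hmul, mul_smul] }, fun u => ?_⟩
    ext x
    change (s x).sum (fun p a => h p (e.symm (MulOpposite.op a) • f u)) = g u x
    have hx : (s x).sum (fun p a => a • p) = x := DFunLike.congr_fun hs x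
    conv_rhs => rw [← hx]
    rw [Finsupp.sum, Finsupp.sum, map_sum]
    refine Finset.sum_congr rfl fun p _ => ?_
    rw [← map_smul, hh, map_smul, smul_apply]
    simp

end CharDual

end CharacterDual

section NatInf

theorem natInf_le {s : Set ℕ} {n : ℕ} (h : n ∈ s) :
    sInf ((fun n : ℕ => (n : ℕ∞)) '' s) ≤ n :=
  sInf_le ⟨n, h, rfl⟩

theorem isLeast_of_natInf_eq {s : Set ℕ} {n : ℕ}
    (h : sInf ((fun n : ℕ => (n : ℕ∞)) '' s) = n) : IsLeast s n := by
  have hne : ((fun n : ℕ => (n : ℕ∞)) '' s).Nonempty := by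
    by_contra hs
    rw [Set.not_nonempty_iff_eq_empty.1 hs, sInf_empty] at h
    exact ENat.top_ne_natCast n h
  obtain ⟨m, hm, hmn⟩ := csInf_mem hne
  have hmn' : m = n := by
    rw [h] at hmn
    exact Nat.cast_injective (R := ℕ∞) hmn
  refine ⟨hmn' ▸ hm, fun k hk => ?_⟩
  have := natInf_le hk
  rw [h] at this
  exact_mod_cast this

end NatInf

section Delooping

open CategoryTheory Abelian

variable {A B : Type} [Ring A] [Ring B]

theorem extVanishes_of_projective {N : ModuleCat.{0} B} [Module.Projective B N]
    (Y : ModuleCat.{0} B) (n : ℕ) : ExtVanishes (n + 1) N Y := by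
  have : Projective N := (IsProjective.iff_projective (R := B) N).1 inferInstance
  exact subsingleton_of_forall_eq 0 fun z => Ext.eq_zero_of_projective z

theorem extVanishes_of_injective {I : ModuleCat.{0} B} [Module.Injective B I]
    (M : ModuleCat.{0} B) (n : ℕ) : ExtVanishes (n + 1) M I := by
  have : CategoryTheory.Injective I := (Module.injective_iff_injective_object B I).1 inferInstance
  exact subsingleton_of_forall_eq 0 fun z => Ext.eq_zero_of_injective z

theorem extVanishes_of_sum_retract {M Y Z Z' : ModuleCat.{0} B} {n : ℕ} (i : Y →ₗ[B] Z)
    (r : Z →ₗ[B] Y) (i' : Y →ₗ[B] Z') (r' : Z' →ₗ[B] Y) (h : ∀ y, r (i y) + r' (i' y) = y)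
    (hZ : ExtVanishes n M Z) (hZ' : ExtVanishes n M Z') : ExtVanishes n M Y := by
  have hir : ModuleCat.ofHom i ≫ ModuleCat.ofHom r + ModuleCat.ofHom i' ≫ ModuleCat.ofHom r' =
      𝟙 Y := by
    ext y; exact h y
  refine subsingleton_of_forall_eq 0 fun z : Ext M Y n => ?_
  have hz : (z.comp (Ext.mk₀ (ModuleCat.ofHom i)) (add_zero n)).comp
      (Ext.mk₀ (ModuleCat.ofHom r)) (add_zero n) +
      (z.comp (Ext.mk₀ (ModuleCat.ofHom i')) (add_zero n)).comp
      (Ext.mk₀ (ModuleCat.ofHom r')) (add_zero n) = z := by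
    rw [Ext.comp_assoc_of_third_deg_zero, Ext.comp_assoc_of_third_deg_zero, Ext.mk₀_comp_mk₀,
      Ext.mk₀_comp_mk₀, ← Ext.comp_add, ← Ext.mk₀_add, hir, Ext.comp_mk₀_id]
  rw [← hz, hZ.elim (z.comp (Ext.mk₀ (ModuleCat.ofHom i)) (add_zero n)) 0,
    hZ'.elim (z.comp (Ext.mk₀ (ModuleCat.ofHom i')) (add_zero n)) 0, Ext.zero_comp, Ext.zero_comp,
    add_zero]

variable (e : B ≃+* Aᵐᵒᵖ)

theorem extVanishes_nthSyzygy_right {N X : ModuleCat.{0} A} {k : ℕ} (h : IsNthSyzygyOf A k N X)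
    (M : ModuleCat.{0} B) (n : ℕ) :
    ExtVanishes (n + 1) M (ModuleCat.of B (CharDual e N)) ↔
      ExtVanishes (n + k + 1) M (ModuleCat.of B (CharDual e X)) := by
  induction k generalizing N n with
  | zero =>
    obtain ⟨f⟩ := h
    constructor
    · refine extVanishes_of_retract (CharDual.map f.toLinearMap) (CharDual.map f.symm.toLinearMap)
        fun y : CharDual e X => ?_
      refine CharDual.ext (X := X) fun x => ?_
      simp
    · refine extVanishes_of_retract (CharDual.map f.symm.toLinearMap) (CharDual.map f.toLinearMap)
        fun y : CharDual e N => ?_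
      refine CharDual.ext (X := N) fun x => ?_
      simp
  | succ k ih =>
    obtain ⟨K, hK, hN⟩ := h
    obtain ⟨P, i, p, hP, -, hex, hi, hp, -⟩ := exists_exact_of_isSyzygyOf hN
    have := extVanishes_shift_right (Y := ModuleCat.of B (CharDual e K))
      (I := ModuleCat.of B (CharDual e P)) (Y' := ModuleCat.of B (CharDual e N))
      (CharDual.map_exact (e := e) hex hp)
      (CharDual.map_injective hp) (CharDual.map_surjective hi) M n
    rw [this, show n + (k + 1) + 1 = (n + 1) + k + 1 by omega, ← ih hK (n + 1)]

theorem extVanishes_of_isDirectSummandOf {N N' : ModuleCat.{0} A}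
    (h : IsDirectSummandOf A N (ModuleCat.of A (A × N'))) {M : ModuleCat.{0} B} {n : ℕ}
    (hv : ExtVanishes (n + 1) M (ModuleCat.of B (CharDual e N'))) :
    ExtVanishes (n + 1) M (ModuleCat.of B (CharDual e N)) := by
  obtain ⟨C, ⟨f⟩⟩ := h
  let f' : (A × N') ≃ₗ[A] (N × C) := f
  have hprod : ExtVanishes (n + 1) M (ModuleCat.of B (CharDual e (A × N'))) := by
    refine extVanishes_of_sum_retract (Z := ModuleCat.of B (CharDual e A))
      (Z' := ModuleCat.of B (CharDual e N'))
      (CharDual.map (LinearMap.inl A A N')) (CharDual.map (LinearMap.fst A A N'))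
      (CharDual.map (LinearMap.inr A A N')) (CharDual.map (LinearMap.snd A A N'))
      (fun y : CharDual e (A × N') => ?_)
      (extVanishes_of_injective M n) hv
    refine CharDual.ext (X := A × N') fun x => ?_
    change y (x.1, 0) + y (0, x.2) = y x
    rw [← map_add]
    simp
  refine extVanishes_of_retract (Z := ModuleCat.of B (CharDual e (A × N')))
    (CharDual.map (LinearMap.fst A N C ∘ₗ f'.toLinearMap))
    (CharDual.map (f'.symm.toLinearMap ∘ₗ LinearMap.inl A N C)) (fun y : CharDual e N => ?_) hprod
  refine CharDual.ext (X := N) fun x => ?_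
  change y (f' (f'.symm (x, 0))).1 = y x
  simp

theorem isSemisimpleModule_charDual [IsArtinianRing B] (S : Type) [AddCommGroup S] [Module A S]
    [IsSimpleModule A S] : IsSemisimpleModule B (CharDual e S) := by
  have key : ∀ j ∈ Ring.jacobson B, ∀ s : S, (e j).unop • s = 0 := by
    intro j hj s
    by_contra hs
    obtain ⟨a, ha⟩ := IsSimpleModule.toSpanSingleton_surjective A hs s
    obtain ⟨b, hb⟩ : ∃ b, e b = MulOpposite.op a := ⟨e.symm (MulOpposite.op a), by simp⟩
    have hjb : (e (j * b)).unop • s = s := by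
      simpa [hb, mul_smul] using ha
    have hmem : j * b ∈ Ring.jacobson B := Ideal.mul_mem_right _ _ hj
    obtain ⟨n, hn⟩ := ((isSemiprimaryRing_iff B).1 inferInstance).2
    have hpow : ∀ k, (e ((j * b) ^ k)).unop • s = s := by
      intro k
      induction k with
      | zero => simp
      | succ k ih => rw [pow_succ, map_mul, MulOpposite.unop_mul, mul_smul, ih, hjb]
    have h0 : (j * b) ^ n = 0 := by
      simpa [hn] using Ideal.pow_mem_pow hmem n
    have hs0 : s = 0 := by simpa [h0] using (hpow n).symm
    exact hs (by rw [hs0, smul_zero])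
  have h : Ring.jacobson B ≤ Module.annihilator B (CharDual e S) := fun j hj =>
    Module.mem_annihilator.2 fun c => CharDual.ext fun s => by
      rw [CharDual.smul_apply, key j hj, map_zero, CharDual.zero_apply]
  rw [← SetLike.coe_subset_coe, ← Module.isTorsionBySet_iff_subset_annihilator] at h
  let _ := h.module
  exact (h.semilinearMap.isSemisimpleModule_iff_of_bijective Function.bijective_id).2 inferInstance

theorem exists_simple_pairing (e : B ≃+* Aᵐᵒᵖ) [IsArtinianRing A] (N : Type)
    [AddCommGroup N] [Module B N]
    [Nontrivial N] : ∃ (S : ModuleCat.{0} A), IsSimpleModule A S ∧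
      ∃ g : N →ₗ[B] CharDual e S, g ≠ 0 := by
  let e' : A ≃+* Bᵐᵒᵖ := (RingEquiv.opOp A).trans e.op.symm
  have he' : ∀ b : B, (e' (e b).unop).unop = b := fun b => by simp [e']
  obtain ⟨x, hx⟩ := exists_ne (0 : N)
  obtain ⟨c, hc⟩ := CharacterModule.exists_character_apply_ne_zero_of_ne_zero (A := N) hx
  let c' : CharDual e' N := c
  have hc' : c' ≠ 0 := fun h => hc (DFunLike.congr_fun h x)
  have : Nontrivial (A ∙ c') :=
    ⟨⟨c', Submodule.mem_span_singleton_self c'⟩, 0, fun h => hc' (congrArg Subtype.val h)⟩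
  obtain ⟨S, hS⟩ := IsAtomic.exists_atom (Submodule A (A ∙ c'))
  have hS' : IsSimpleModule A S := isSimpleModule_iff_isAtom.2 hS
  let g : N →ₗ[B] CharDual e S :=
    { toFun := fun t => show S →+ AddCircle (1 : ℚ) from
        { toFun := fun s => (s : A ∙ c').1 t
          map_zero' := rfl
          map_add' := fun _ _ => rfl }
      map_add' := fun t t' => CharDual.ext fun s => map_add (s : A ∙ c').1 t t'
      map_smul' := fun b t => CharDual.ext fun s => by
        change (s : A ∙ c').1 (b • t) = (s : A ∙ c').1 ((e' (e b).unop).unop • t)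
        rw [he'] }
  refine ⟨ModuleCat.of A S, hS', g, fun hg => ?_⟩
  have := IsSimpleModule.nontrivial A S
  obtain ⟨s, hs⟩ := exists_ne (0 : S)
  exact hs (Subtype.ext (Subtype.ext (CharDual.ext fun t =>
    DFunLike.congr_fun (LinearMap.congr_fun hg t) s)))

theorem le_jacobson_of_isSmallSubmodule {P : Type} [AddCommGroup P] [Module B P]
    {N : Submodule B P} (h : IsSmallSubmodule B N) : N ≤ Module.jacobson B P := by
  refine le_sInf fun K hK => ?_
  by_contra hN
  exact hK.1 (h K ((hK.2 _ (right_lt_sup.2 hN))))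

theorem finDim_le_delAlg (e : B ≃+* Aᵐᵒᵖ) [IsArtinianRing A] [IsArtinianRing B] :
    finDim B ≤ delAlg A := by
  refine sSup_le ?_
  rintro d ⟨hd, M, -, hM⟩
  obtain ⟨n, rfl⟩ := ENat.ne_top_iff_exists.1 hd
  obtain ⟨⟨N, hN, hNp⟩, hmin⟩ := isLeast_of_natInf_eq hM
  cases n with
  | zero => exact bot_le
  | succ k =>
    obtain ⟨K, hK, hNK⟩ := hN
    obtain ⟨P, i, p, hP, -, hex, hi, hp, hs⟩ := exists_exact_of_isSyzygyOf hNK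
    have hnt : Nontrivial N := by
      by_contra h
      rw [not_nontrivial_iff_subsingleton] at h
      have hpi : Injective p := by
        rw [← LinearMap.ker_eq_bot, LinearMap.exact_iff.1 hex, LinearMap.range_eq_bot]
        exact LinearMap.ext fun x => by rw [Subsingleton.elim x 0, map_zero, map_zero]
      have hKp : Module.Projective B K :=
        Module.Projective.of_equiv (LinearEquiv.ofBijective p ⟨hpi, hp⟩)
      have := hmin ⟨K, hK, hKp⟩
      omega
    obtain ⟨S, hS, g, hg⟩ := exists_simple_pairing e N
    refine le_trans (le_sInf ?_) (le_sSup ⟨S, hS, rfl⟩)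
    rintro _ ⟨d, ⟨M', N₀, N', -, hN₀, hN', hsum⟩, rfl⟩
    by_contra hlt
    have hdk : d ≤ k := by
      have : (d : ℕ∞) < ((k + 1 : ℕ) : ℕ∞) := not_le.1 hlt
      have : d < k + 1 := by exact_mod_cast this
      omega
    obtain ⟨m, rfl⟩ := Nat.exists_eq_add_of_le' hdk
    have h₁ : ExtVanishes (m + (d + 1) + 1) M (ModuleCat.of B (CharDual e M')) := by
      have := (extVanishes_nthSyzygy_left (k := m + d + 1) ⟨K, hK, hNK⟩
        (ModuleCat.of B (CharDual e M')) 0).1 (extVanishes_of_projective _ _)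
      rwa [show 0 + (m + d + 1) + 1 = m + (d + 1) + 1 by omega] at this
    have h₂ := (extVanishes_nthSyzygy_right e hN₀ M m).1
      (extVanishes_of_isDirectSummandOf e hsum ((extVanishes_nthSyzygy_right e hN' M m).2 h₁))
    have h₃ : ExtVanishes 1 K (ModuleCat.of B (CharDual e S)) :=
      (extVanishes_nthSyzygy_left hK (ModuleCat.of B (CharDual e S)) 0).2 (by rwa [zero_add])
    obtain ⟨f, hf⟩ := exists_extension_of_extVanishes (Y := ModuleCat.of B (CharDual e S))
      hex hi hp h₃ g
    have := isSemisimpleModule_charDual e S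
    let f' : P →ₗ[B] CharDual e S := f
    have hker := IsSemisimpleModule.jacobson_le_ker B B P (CharDual e S) f'
    refine hg (LinearMap.ext fun x => ?_)
    have := hker (le_jacobson_of_isSmallSubmodule hs ⟨x, rfl⟩)
    rw [← hf]
    exact this

end Delooping

section Length

variable (A : Type) [Ring A]

/-- The length of a module as a natural number. -/
def len (M : Type) [AddCommGroup M] [Module A M] : ℕ := (Module.length A M).toNat

variable {A} {M N : Type} [AddCommGroup M] [Module A M] [AddCommGroup N] [Module A N]

theorem len_congr (e : M ≃ₗ[A] N) : len A M = len A N := by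
  rw [len, len, e.length_eq]

theorem len_eq_one (M : Type) [AddCommGroup M] [Module A M] [IsSimpleModule A M] :
    len A M = 1 := by
  rw [len, Module.length_eq_one]
  rfl

theorem len_eq_one_of_isCoatom {K : Submodule A M} (h : IsCoatom K) :
    len A (M ⧸ K) = 1 := by
  have := isSimpleModule_iff_isCoatom.2 h
  exact len_eq_one _

theorem len_map_of_injective {f : M →ₗ[A] N} (hf : Injective f) (K : Submodule A M) :
    len A (K.map f) = len A K :=
  len_congr (Submodule.equivMapOfInjective f hf K).symm

theorem len_range_of_injective {f : M →ₗ[A] N} (hf : Injective f) :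
    len A (LinearMap.range f) = len A M :=
  len_congr (LinearEquiv.ofInjective f hf).symm

theorem len_top : len A (⊤ : Submodule A M) = len A M := len_congr Submodule.topEquiv

variable [IsArtinianRing A]

theorem coe_len [Module.Finite A M] : (len A M : ℕ∞) = Module.length A M :=
  ENat.natCast_toNat Module.length_ne_top

theorem len_eq_zero_iff [Module.Finite A M] : len A M = 0 ↔ Subsingleton M := by
  rw [← Module.length_eq_zero_iff (R := A), ← coe_len]
  norm_cast

theorem len_pos_iff [Module.Finite A M] : 0 < len A M ↔ Nontrivial M := by
  rw [Nat.pos_iff_ne_zero, Ne, len_eq_zero_iff, not_subsingleton_iff_nontrivial]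

theorem len_submodule_eq_zero_iff [Module.Finite A M] {K : Submodule A M} :
    len A K = 0 ↔ K = ⊥ := by
  rw [len_eq_zero_iff, Submodule.subsingleton_iff_eq_bot]

theorem len_quotient_add [Module.Finite A M] (K : Submodule A M) :
    len A (M ⧸ K) + len A K = len A M := by
  have := Module.length_eq_add_of_exact K.subtype K.mkQ K.injective_subtype K.mkQ_surjective
    (LinearMap.exact_subtype_mkQ K)
  rw [← coe_len, ← coe_len, ← coe_len] at this
  have : len A M = len A K + len A (M ⧸ K) := by exact_mod_cast this
  omega

theorem len_range_add_ker [Module.Finite A M] (f : M →ₗ[A] N) :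
    len A (LinearMap.range f) + len A (LinearMap.ker f) = len A M := by
  rw [← len_quotient_add (LinearMap.ker f), len_congr f.quotKerEquivRange]

theorem len_add_ker_of_surjective [Module.Finite A M] {f : M →ₗ[A] N} (hf : Surjective f) :
    len A N + len A (LinearMap.ker f) = len A M := by
  rw [← len_quotient_add (LinearMap.ker f), len_congr (f.quotKerEquivOfSurjective hf)]

theorem len_map_add_ker [Module.Finite A M] (f : M →ₗ[A] N) {K : Submodule A M}
    (h : LinearMap.ker f ≤ K) :
    len A (K.map f) + len A (LinearMap.ker f) = len A K := by
  have h1 := len_range_add_ker (f.domRestrict K)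
  rw [LinearMap.range_domRestrict, LinearMap.ker_domRestrict] at h1
  have h2 : len A (Submodule.comap K.subtype (LinearMap.ker f)) = len A (LinearMap.ker f) :=
    len_congr (Submodule.submoduleOfEquivOfLe h)
  rwa [h2] at h1

theorem len_mono [Module.Finite A M] {K L : Submodule A M} (h : K ≤ L) : len A K ≤ len A L := by
  have := len_quotient_add (K.submoduleOf L)
  rw [len_congr (Submodule.submoduleOfEquivOfLe h)] at this
  omega

theorem eq_of_le_of_len_le [Module.Finite A M] {K L : Submodule A M} (h : K ≤ L)
    (hl : len A L ≤ len A K) : K = L := by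
  have := len_quotient_add (K.submoduleOf L)
  rw [len_congr (Submodule.submoduleOfEquivOfLe h)] at this
  have h0 : len A (L ⧸ K.submoduleOf L) = 0 := by omega
  rw [len_eq_zero_iff, Submodule.Quotient.subsingleton_iff] at h0
  exact le_antisymm h (Submodule.comap_subtype_eq_top.1 h0)

theorem eq_top_of_len_le [Module.Finite A M] {K : Submodule A M} (h : len A M ≤ len A K) :
    K = ⊤ :=
  eq_of_le_of_len_le le_top (by rwa [len_top])

theorem len_le [Module.Finite A M] (K : Submodule A M) : len A K ≤ len A M := by
  have := len_quotient_add K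
  omega

theorem len_sup_add_inf [Module.Finite A M] (K L : Submodule A M) :
    len A (K ⊔ L : Submodule A M) + len A (K ⊓ L : Submodule A M) = len A K + len A L := by
  have h1 := len_quotient_add ((K ⊓ L).submoduleOf K)
  have h2 := len_quotient_add (L.submoduleOf (K ⊔ L))
  rw [len_congr (Submodule.submoduleOfEquivOfLe (inf_le_left : K ⊓ L ≤ K))] at h1
  rw [len_congr (Submodule.submoduleOfEquivOfLe (le_sup_right : L ≤ K ⊔ L))] at h2
  have h3 : len A (K ⧸ (K ⊓ L).submoduleOf K) = len A (_ ⧸ L.submoduleOf (K ⊔ L)) :=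
    len_congr (LinearMap.quotientInfEquivSupQuotient K L)
  omega

end Length

section Uniserial

variable (A : Type) [Ring A]

/-- A module whose submodules form a chain. -/
def Uniserial (M : Type) [AddCommGroup M] [Module A M] : Prop :=
  ∀ K L : Submodule A M, K ≤ L ∨ L ≤ K

variable {A} {M N : Type} [AddCommGroup M] [Module A M] [AddCommGroup N] [Module A N]

theorem Uniserial.of_injective (h : Uniserial A N) {f : M →ₗ[A] N} (hf : Injective f) :
    Uniserial A M := fun K L =>
  (h (K.map f) (L.map f)).imp (Submodule.map_le_map_iff_of_injective hf K L).1
    (Submodule.map_le_map_iff_of_injective hf L K).1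

theorem Uniserial.of_surjective (h : Uniserial A M) {f : M →ₗ[A] N} (hf : Surjective f) :
    Uniserial A N := fun K L =>
  (h (K.comap f) (L.comap f)).imp (Submodule.comap_le_comap_iff_of_surjective hf).1
    (Submodule.comap_le_comap_iff_of_surjective hf).1

theorem Uniserial.isSmallSubmodule (h : Uniserial A M) {K : Submodule A M} (hK : K ≠ ⊤) :
    IsSmallSubmodule A K := fun L hL => by
  rcases h K L with hle | hle
  · rwa [sup_eq_right.2 hle] at hL
  · exact absurd ((sup_eq_left.2 hle) ▸ hL) hK

theorem Uniserial.le_of_len_le [IsArtinianRing A] [Module.Finite A M] (h : Uniserial A M)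
    {K L : Submodule A M} (hl : len A K ≤ len A L) : K ≤ L :=
  (h K L).elim id fun hle => (eq_of_le_of_len_le hle hl).ge

theorem Uniserial.eq_of_len_eq [IsArtinianRing A] [Module.Finite A M] (h : Uniserial A M)
    {K L : Submodule A M} (hl : len A K = len A L) : K = L :=
  le_antisymm (h.le_of_len_le hl.le) (h.le_of_len_le hl.ge)

theorem Uniserial.exists_surjective [IsNoetherian A M] (h : Uniserial A M) :
    ∃ f : A →ₗ[A] M, Surjective f := by
  obtain ⟨_, ⟨x, rfl⟩, hmax⟩ := set_has_maximal_iff_noetherian.2 ‹IsNoetherian A M›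
    (Set.range fun x : M => Submodule.span A {x}) (Set.range_nonempty _)
  refine ⟨LinearMap.toSpanSingleton A M x, fun y => ?_⟩
  have hy : y ∈ Submodule.span A {x} := by
    rcases h (Submodule.span A {x}) (Submodule.span A {y}) with hle | hle
    · have := hmax _ ⟨y, rfl⟩
      rw [show Submodule.span A {x} = Submodule.span A {y} from
        hle.eq_of_not_lt this]
      exact Submodule.mem_span_singleton_self y
    · exact hle (Submodule.mem_span_singleton_self y)
  exact Submodule.mem_span_singleton.1 hy

end Uniserial

section Cover

variable {A : Type} [Ring A] {P P' M M' : Type} [AddCommGroup P] [Module A P]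
  [AddCommGroup P'] [Module A P'] [AddCommGroup M'] [Module A M'] [AddCommGroup M] [Module A M]

/-- Projective covers of isomorphic modules are isomorphic. -/
theorem exists_linearEquiv_of_covers [Module.Projective A P] [Module.Projective A P']
    {f : P →ₗ[A] M} {f' : P' →ₗ[A] M'} (hf : Surjective f) (hf' : Surjective f')
    (hs : IsSmallSubmodule A (LinearMap.ker f)) (hs' : IsSmallSubmodule A (LinearMap.ker f'))
    (e : M ≃ₗ[A] M') : ∃ φ : P ≃ₗ[A] P', ∀ x, f' (φ x) = e (f x) := by
  obtain ⟨φ, hφ⟩ := Module.projective_lifting_property f' (e.toLinearMap ∘ₗ f) hf'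
  have hφ' : ∀ x, f' (φ x) = e (f x) := fun x => LinearMap.congr_fun hφ x
  have hφs : LinearMap.range φ = ⊤ := hs' _ (by
    refine eq_top_iff.2 fun y _ => ?_
    obtain ⟨x, hx⟩ := hf (e.symm (f' y))
    refine Submodule.mem_sup.2 ⟨y - φ x, ?_, φ x, ⟨x, rfl⟩, sub_add_cancel _ _⟩
    rw [LinearMap.mem_ker, map_sub, hφ', hx, e.apply_symm_apply, sub_self])
  obtain ⟨s, hsec⟩ := φ.exists_rightInverse_of_surjective hφs
  have hsec' : ∀ y, φ (s y) = y := fun y => LinearMap.congr_fun hsec y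
  have hss : LinearMap.range s = ⊤ := hs _ (by
    refine eq_top_iff.2 fun x _ => ?_
    refine Submodule.mem_sup.2 ⟨x - s (φ x), ?_, s (φ x), ⟨_, rfl⟩, sub_add_cancel _ _⟩
    rw [LinearMap.mem_ker, map_sub, sub_eq_zero]
    apply e.injective
    rw [← hφ', ← hφ', hsec'])
  refine ⟨LinearEquiv.ofBijective φ ⟨?_, LinearMap.range_eq_top.1 hφs⟩, hφ'⟩
  intro x y hxy
  obtain ⟨x', rfl⟩ := LinearMap.range_eq_top.1 hss x
  obtain ⟨y', rfl⟩ := LinearMap.range_eq_top.1 hss y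
  rw [hsec', hsec'] at hxy
  rw [hxy]

theorem exists_ker_linearEquiv_of_covers [Module.Projective A P] [Module.Projective A P']
    {f : P →ₗ[A] M} {f' : P' →ₗ[A] M'} (hf : Surjective f) (hf' : Surjective f')
    (hs : IsSmallSubmodule A (LinearMap.ker f)) (hs' : IsSmallSubmodule A (LinearMap.ker f'))
    (e : M ≃ₗ[A] M') : Nonempty (LinearMap.ker f ≃ₗ[A] LinearMap.ker f') := by
  obtain ⟨φ, hφ⟩ := exists_linearEquiv_of_covers hf hf' hs hs' e
  refine ⟨φ.ofSubmodules _ _ ?_⟩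
  ext y
  rw [Submodule.mem_map_equiv, LinearMap.mem_ker, LinearMap.mem_ker, ← e.map_eq_zero_iff, ← hφ,
    φ.apply_symm_apply]

theorem nonempty_linearEquiv_of_isSyzygyOf {N N' M M' : ModuleCat.{0} A} (h : IsSyzygyOf A N M)
    (h' : IsSyzygyOf A N' M') (e : M ≃ₗ[A] M') : Nonempty (N ≃ₗ[A] N') := by
  obtain ⟨P, f, hP, -, hf, hs, ⟨i⟩⟩ := h
  obtain ⟨P', f', hP', -, hf', hs', ⟨i'⟩⟩ := h'
  obtain ⟨k⟩ := exists_ker_linearEquiv_of_covers hf hf' hs hs' e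
  exact ⟨i.trans (k.trans i'.symm)⟩

theorem nonempty_linearEquiv_of_isNthSyzygyOf {N N' M : ModuleCat.{0} A} {k : ℕ}
    (h : IsNthSyzygyOf A k N M) (h' : IsNthSyzygyOf A k N' M) : Nonempty (N ≃ₗ[A] N') := by
  induction k generalizing N N' with
  | zero =>
    obtain ⟨e⟩ := h
    obtain ⟨e'⟩ := h'
    exact ⟨e.trans e'.symm⟩
  | succ k ih =>
    obtain ⟨K, hK, hN⟩ := h
    obtain ⟨K', hK', hN'⟩ := h'
    obtain ⟨e⟩ := ih hK hK'
    exact nonempty_linearEquiv_of_isSyzygyOf hN hN' e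

end Cover

section UniserialProjective

variable {A : Type} [Ring A]

/-- Finitely generated projective modules whose submodules form a chain. -/
structure UniserialProjective (Q : ModuleCat.{0} A) : Prop where
  projective : Module.Projective A Q
  finite : Module.Finite A Q
  uniserial : Uniserial A Q

theorem exists_uniserialProjective_cover [IsArtinianRing A] (hA : IsNakayamaRing A) {K : Type}
    [AddCommGroup K] [Module A K] [Module.Finite A K] (hK : Uniserial A K) :
    ∃ (P : ModuleCat.{0} A) (f : P →ₗ[A] K), UniserialProjective P ∧ Surjective f ∧
      IsSmallSubmodule A (LinearMap.ker f) := by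
  rcases subsingleton_or_nontrivial K with hsub | hnt
  · refine ⟨ModuleCat.of A PUnit, 0, ⟨inferInstance, inferInstance, fun K L => ?_⟩,
      fun y => ⟨0, Subsingleton.elim _ _⟩, fun L _ => Subsingleton.elim _ _⟩
    exact Or.inl (Subsingleton.elim K L).le
  obtain ⟨g, hg⟩ := hK.exists_surjective
  let s : Set (Submodule A A) := {X | (∃ r : A →ₗ[A] X, ∀ x : X, r x = x) ∧
    ∃ f : X →ₗ[A] K, Surjective f}
  have hs : s.Nonempty := ⟨⊤, ⟨Submodule.topEquiv.symm.toLinearMap, fun x => rfl⟩,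
    g ∘ₗ Submodule.topEquiv.toLinearMap, hg.comp Submodule.topEquiv.surjective⟩
  obtain ⟨X, ⟨⟨r, hr⟩, f, hf⟩, hmin⟩ := wellFounded_lt.has_min s hs
  have key : ∀ N N' : Submodule A X, IsCompl N N' → N.map f = ⊤ → N = ⊤ := by
    intro N N' hN hNf
    let i := Submodule.equivMapOfInjective X.subtype X.injective_subtype N
    have hmem : N.map X.subtype ∈ s := by
      refine ⟨⟨i.toLinearMap ∘ₗ Submodule.projectionOnto N N' hN ∘ₗ r, ?_⟩,
        f ∘ₗ N.subtype ∘ₗ i.symm.toLinearMap, ?_⟩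
      · intro y
        obtain ⟨n, rfl⟩ := i.surjective y
        have h1 : r (i n : A) = (n : X) := hr n
        simp [h1]
      · intro k
        obtain ⟨n, hn, rfl⟩ : k ∈ N.map f := hNf ▸ Submodule.mem_top
        exact ⟨i ⟨n, hn⟩, by simp⟩
    have hle : N.map X.subtype ≤ X := Submodule.map_subtype_le X N
    have heq : N.map X.subtype = X := hle.eq_of_not_lt (hmin _ hmem)
    refine eq_top_iff.2 fun x _ => ?_
    obtain ⟨n, hn, hnx⟩ : (x : A) ∈ N.map X.subtype := heq.symm ▸ x.2
    rwa [← Subtype.ext hnx]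
  have hXnt : Nontrivial X := hf.nontrivial
  have hind : IndecomposableModule A (ModuleCat.of A X) := by
    refine ⟨hXnt, fun N N' hN => ?_⟩
    have hsup : N.map f ⊔ N'.map f = ⊤ := by
      rw [← Submodule.map_sup, hN.sup_eq_top, Submodule.map_top, LinearMap.range_eq_top.2 hf]
    rcases hK (N.map f) (N'.map f) with h | h
    · rw [sup_eq_right.2 h] at hsup
      have := key N' N hN.symm hsup
      left
      simpa [this] using hN.inf_eq_bot
    · rw [sup_eq_left.2 h] at hsup
      exact Or.inr (key N N' hN hsup)
  have hfin : Module.Finite A X := inferInstance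
  have huni : Uniserial A X := hA.2 (ModuleCat.of A X) hfin hind
  refine ⟨ModuleCat.of A X, f, ⟨?_, hfin, huni⟩, hf, huni.isSmallSubmodule ?_⟩
  · exact Module.Projective.of_split X.subtype r (LinearMap.ext hr)
  · intro h
    obtain ⟨y, hy⟩ := exists_ne (0 : K)
    obtain ⟨x, rfl⟩ := hf y
    exact hy (LinearMap.mem_ker.1 (h ▸ Submodule.mem_top))

theorem isDirectSummandOf_prod {N : ModuleCat.{0} A} (hN : UniserialProjective N)
    [IsArtinianRing A] (N' : ModuleCat.{0} A) :
    IsDirectSummandOf A N (ModuleCat.of A (A × N')) := by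
  have := hN.finite
  have := hN.projective
  obtain ⟨f, hf⟩ := hN.uniserial.exists_surjective
  obtain ⟨s, hs⟩ := f.exists_rightInverse_of_surjective (LinearMap.range_eq_top.2 hf)
  have hs' : ∀ y, f (s y) = y := fun y => LinearMap.congr_fun hs y
  let p : A × N' →ₗ[A] N := f ∘ₗ LinearMap.fst A A N'
  let i : N × LinearMap.ker p →ₗ[A] A × N' :=
    LinearMap.coprod (LinearMap.inl A A N' ∘ₗ s) (LinearMap.ker p).subtype
  have hp : ∀ n : N, p (LinearMap.inl A A N' (s n)) = n := hs'
  have hi : Bijective i := by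
    constructor
    · refine (injective_iff_map_eq_zero i).2 fun ⟨n, k⟩ hnk => ?_
      have hnk' : LinearMap.inl A A N' (s n) + (k : A × N') = 0 := hnk
      have hn : n = 0 := by
        have := congrArg p hnk'
        rwa [map_add, hp, LinearMap.mem_ker.1 k.2, add_zero, map_zero] at this
      subst hn
      rw [map_zero, map_zero, zero_add] at hnk'
      rw [show k = 0 from Subtype.ext hnk']
      rfl
    · intro x
      refine ⟨(p x, ⟨x - LinearMap.inl A A N' (s (p x)), ?_⟩), ?_⟩
      · rw [LinearMap.mem_ker, map_sub, hp, sub_self]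
      · exact add_sub_cancel _ _
  exact ⟨ModuleCat.of A (LinearMap.ker p), ⟨(LinearEquiv.ofBijective i hi).symm⟩⟩

theorem isDirectSummandOf_prod_of_linearEquiv {N N' : ModuleCat.{0} A} (e : N ≃ₗ[A] N') :
    IsDirectSummandOf A N (ModuleCat.of A (A × N')) :=
  ⟨ModuleCat.of A A, ⟨(LinearEquiv.prodComm A A N').trans
    (e.symm.prodCongr (LinearEquiv.refl A A))⟩⟩

theorem uniserial_finite_of_isSyzygyOf [IsArtinianRing A] (hA : IsNakayamaRing A)
    {N K : ModuleCat.{0} A} (h : IsSyzygyOf A N K) (hf : Module.Finite A K)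
    (hu : Uniserial A K) : Module.Finite A N ∧ Uniserial A N := by
  obtain ⟨P, f, hP, hfs, hs⟩ := exists_uniserialProjective_cover hA hu
  have := hP.finite
  have hsyz : IsSyzygyOf A (ModuleCat.of A (LinearMap.ker f)) K :=
    ⟨P, f, hP.projective, hP.finite, hfs, hs, ⟨LinearEquiv.refl A _⟩⟩
  obtain ⟨e⟩ := nonempty_linearEquiv_of_isSyzygyOf h hsyz (LinearEquiv.refl A K)
  let e' : N ≃ₗ[A] LinearMap.ker f := e
  exact ⟨Module.Finite.equiv e'.symm, (hP.uniserial.of_injective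
    (Submodule.injective_subtype _)).of_injective (f := e'.toLinearMap) e'.injective⟩

theorem uniserial_finite_of_isNthSyzygyOf [IsArtinianRing A] (hA : IsNakayamaRing A)
    {N K : ModuleCat.{0} A} {n : ℕ} (h : IsNthSyzygyOf A n N K) (hf : Module.Finite A K)
    (hu : Uniserial A K) : Module.Finite A N ∧ Uniserial A N := by
  induction n generalizing N with
  | zero =>
    obtain ⟨e⟩ := h
    exact ⟨Module.Finite.equiv e.symm, hu.of_injective (f := e.toLinearMap) e.injective⟩
  | succ n ih =>
    obtain ⟨L, hL, hN⟩ := h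
    obtain ⟨hLf, hLu⟩ := ih hL
    exact uniserial_finite_of_isSyzygyOf hA hN hLf hLu

theorem isNthSyzygyOf_punit (n : ℕ) :
    IsNthSyzygyOf A n (ModuleCat.of A PUnit) (ModuleCat.of A PUnit) := by
  induction n with
  | zero => exact ⟨LinearEquiv.refl A _⟩
  | succ n ih =>
    refine ⟨_, ih, ModuleCat.of A PUnit, LinearMap.id, inferInstance, inferInstance,
      surjective_id, fun L _ => Subsingleton.elim _ _, ?_⟩
    exact ⟨(LinearEquiv.ofTop _ (Subsingleton.elim (α := Submodule A PUnit) _ _)).symm⟩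

theorem uniserial_of_isSimpleModule (S : Type) [AddCommGroup S] [Module A S]
    [IsSimpleModule A S] : Uniserial A S := fun K L => by
  rcases eq_bot_or_eq_top K with rfl | rfl
  · exact Or.inl bot_le
  · exact Or.inr le_top

theorem delMod_le_projDim [IsArtinianRing A] (hA : IsNakayamaRing A) (S : ModuleCat.{0} A)
    [IsSimpleModule A S] : delMod A S ≤ projDim A S := by
  by_cases htop : projDim A S = ⊤
  · rw [htop]
    exact le_top
  obtain ⟨n, hn⟩ := ENat.ne_top_iff_exists.1 htop
  obtain ⟨⟨N, hN, hNp⟩, -⟩ := isLeast_of_natInf_eq hn.symm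
  rw [← hn]
  obtain ⟨hNf, hNu⟩ := uniserial_finite_of_isNthSyzygyOf hA hN inferInstance
    (uniserial_of_isSimpleModule S)
  exact natInf_le ⟨ModuleCat.of A PUnit, N, ModuleCat.of A PUnit, inferInstance, hN,
    isNthSyzygyOf_punit _, isDirectSummandOf_prod ⟨hNp, hNf, hNu⟩ _⟩

end UniserialProjective

section Amalgam

variable {A : Type} [Ring A]

theorem Uniserial.le_total_of_le {M : Type} [AddCommGroup M] [Module A M] {X W W' : Submodule A M}
    (h : Uniserial A X) (hW : W ≤ X) (hW' : W' ≤ X) : W ≤ W' ∨ W' ≤ W := by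
  refine (h (W.submoduleOf X) (W'.submoduleOf X)).imp (fun hle w hw => ?_) (fun hle w hw => ?_)
  · exact hle (show (⟨w, hW hw⟩ : X) ∈ W.submoduleOf X from hw)
  · exact hle (show (⟨w, hW' hw⟩ : X) ∈ W'.submoduleOf X from hw)

variable [IsArtinianRing A]

theorem len_prod {M N : Type} [AddCommGroup M] [Module A M] [AddCommGroup N] [Module A N]
    [Module.Finite A M] [Module.Finite A N] : len A (M × N) = len A M + len A N := by
  have := Module.length_prod A M N
  rw [← coe_len, ← coe_len, ← coe_len] at this
  exact_mod_cast this

/-- Over a Nakayama ring, two uniserial modules of length two with isomorphic socles are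
isomorphic: their amalgam along the socle has to decompose. -/
theorem nonempty_linearEquiv_of_common_socle (hA : IsNakayamaRing A) {T U U' : Type}
    [AddCommGroup T] [Module A T] [AddCommGroup U] [Module A U] [AddCommGroup U'] [Module A U']
    [Module.Finite A U] [Module.Finite A U'] {i : T →ₗ[A] U} {i' : T →ₗ[A] U'}
    (hi : Injective i) (hi' : Injective i') (hT : len A T = 1) (hU : len A U = 2)
    (hU' : len A U' = 2) (hu : Uniserial A U) (hu' : Uniserial A U') :
    Nonempty (U ≃ₗ[A] U') := by
  let W : Submodule A (U × U') := LinearMap.range (i.prod (-i'))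
  let a : U →ₗ[A] (U × U') ⧸ W := W.mkQ ∘ₗ LinearMap.inl A U U'
  let b : U' →ₗ[A] (U × U') ⧸ W := W.mkQ ∘ₗ LinearMap.inr A U U'
  have hW : len A W = 1 := by
    rw [len_range_of_injective, hT]
    intro x y hxy
    exact hi (congrArg Prod.fst hxy)
  have hE : len A ((U × U') ⧸ W) = 3 := by
    have h1 := len_quotient_add W
    have h2 := len_prod (A := A) (M := U) (N := U')
    omega
  have ha : Injective a := by
    refine (injective_iff_map_eq_zero a).2 fun u h0 => ?_
    obtain ⟨t, ht⟩ : (u, (0 : U')) ∈ W := (Submodule.Quotient.mk_eq_zero W).1 h0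
    have h1 : i t = u := congrArg Prod.fst ht
    have h2 : -i' t = 0 := congrArg Prod.snd ht
    rw [neg_eq_zero, map_eq_zero_iff i' hi'] at h2
    rw [← h1, h2, map_zero]
  have hb : Injective b := by
    refine (injective_iff_map_eq_zero b).2 fun u h0 => ?_
    obtain ⟨t, ht⟩ : ((0 : U), u) ∈ W := (Submodule.Quotient.mk_eq_zero W).1 h0
    have h1 : i t = 0 := congrArg Prod.fst ht
    have h2 : -i' t = u := congrArg Prod.snd ht
    rw [map_eq_zero_iff i hi] at h1
    rw [← h2, h1, map_zero, neg_zero]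
  have hab : a ∘ₗ i = b ∘ₗ i' := by
    refine LinearMap.ext fun t => ?_
    refine (Submodule.Quotient.eq W).2 ⟨t, ?_⟩
    ext <;> simp
  have hsup : LinearMap.range a ⊔ LinearMap.range b = ⊤ := by
    refine eq_top_iff.2 fun x _ => ?_
    obtain ⟨⟨u, u'⟩, rfl⟩ := W.mkQ_surjective x
    refine Submodule.mem_sup.2 ⟨a u, ⟨u, rfl⟩, b u', ⟨u', rfl⟩, ?_⟩
    simp only [a, b, LinearMap.comp_apply, ← map_add]
    simp
  have hX : Uniserial A (LinearMap.range a) := hu.of_surjective a.surjective_rangeRestrict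
  have hY : Uniserial A (LinearMap.range b) := hu'.of_surjective b.surjective_rangeRestrict
  have hlX : len A (LinearMap.range a) = 2 := by rw [len_range_of_injective ha, hU]
  have hlY : len A (LinearMap.range b) = 2 := by rw [len_range_of_injective hb, hU']
  have hlT : len A (LinearMap.range (a ∘ₗ i)) = 1 := by
    rw [len_range_of_injective (f := a ∘ₗ i) (show Injective (a ∘ₗ i) from ha.comp hi), hT]
  have hTX : LinearMap.range (a ∘ₗ i) ≤ LinearMap.range a := LinearMap.range_comp_le_range i a
  have hTY : LinearMap.range (a ∘ₗ i) ≤ LinearMap.range b :=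
    hab ▸ LinearMap.range_comp_le_range i' b
  have hnot : ¬ Uniserial A ((U × U') ⧸ W) := by
    intro h
    have htop := len_top (A := A) (M := (U × U') ⧸ W)
    rcases h (LinearMap.range a) (LinearMap.range b) with hle | hle
    · rw [sup_eq_right.2 hle] at hsup
      rw [hsup] at hlY
      omega
    · rw [sup_eq_left.2 hle] at hsup
      rw [hsup] at hlX
      omega
  have hsimple : ∀ N Z : Submodule A ((U × U') ⧸ W), len A N = 1 → Uniserial A Z →
      LinearMap.range (a ∘ₗ i) ≤ Z → N ≤ Z → N = LinearMap.range (a ∘ₗ i) := by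
    intro N Z hN hZ hTZ hNZ
    rcases hZ.le_total_of_le hNZ hTZ with hle | hle
    · exact eq_of_le_of_len_le hle (by omega)
    · exact (eq_of_le_of_len_le hle (by omega)).symm
  have hsplit : ∀ N N' : Submodule A ((U × U') ⧸ W), IsCompl N N' → len A N = 1 →
      Nonempty (U ≃ₗ[A] U') := by
    intro N N' hN hN1
    have hlN' : len A N + len A N' = 3 := by
      have := len_sup_add_inf N N'
      rw [hN.sup_eq_top, hN.inf_eq_bot, len_top,
        (len_submodule_eq_zero_iff (A := A)).2 rfl] at this
      omega
    by_cases hNT : N = LinearMap.range (a ∘ₗ i)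
    · exfalso
      have hbot : N' ⊓ LinearMap.range a = ⊥ := by
        rcases hX.le_total_of_le (inf_le_right : N' ⊓ LinearMap.range a ≤ _) hTX with hle | hle
        · have : N' ⊓ LinearMap.range a ≤ N ⊓ N' := le_inf (hNT ▸ hle) inf_le_left
          rwa [hN.inf_eq_bot, le_bot_iff] at this
        · have : N ≤ N ⊓ N' := le_inf le_rfl (hNT ▸ hle.trans inf_le_left)
          rw [hN.inf_eq_bot, le_bot_iff, ← len_submodule_eq_zero_iff] at this
          omega
      have h1 := len_sup_add_inf N' (LinearMap.range a)
      have h2 := len_le (N' ⊔ LinearMap.range a)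
      rw [hbot, (len_submodule_eq_zero_iff (A := A)).2 rfl] at h1
      omega
    · have hcompl : ∀ Z : Submodule A ((U × U') ⧸ W), len A Z = 2 → Uniserial A Z →
          LinearMap.range (a ∘ₗ i) ≤ Z → IsCompl N Z := by
        intro Z hZ2 hZ hTZ
        have hinf : N ⊓ Z = ⊥ := by
          rw [← len_submodule_eq_zero_iff (A := A)]
          by_contra hne
          refine hNT (hsimple N Z hN1 hZ hTZ ?_)
          have : N ⊓ Z = N := eq_of_le_of_len_le inf_le_left (by omega)
          rw [← this]
          exact inf_le_right
        refine IsCompl.of_eq hinf (eq_top_of_len_le ?_)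
        have := len_sup_add_inf N Z
        rw [hinf, (len_submodule_eq_zero_iff (A := A)).2 rfl] at this
        omega
      exact ⟨(LinearEquiv.ofInjective a ha).trans
        ((Submodule.quotientEquivOfIsCompl _ _ (hcompl _ hlX hX hTX)).symm.trans
        ((Submodule.quotientEquivOfIsCompl _ _ (hcompl _ hlY hY hTY)).trans
        (LinearEquiv.ofInjective b hb).symm))⟩
  have hnt : Nontrivial ((U × U') ⧸ W) := (len_pos_iff (A := A)).1 (by omega)
  by_contra hcon
  refine hnot (hA.2 (ModuleCat.of A ((U × U') ⧸ W)) inferInstance ⟨hnt, fun N N' hN => ?_⟩)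
  have h1 := len_sup_add_inf N N'
  rw [hN.sup_eq_top, hN.inf_eq_bot, len_top, (len_submodule_eq_zero_iff (A := A)).2 rfl] at h1
  have h2 : len A N ≠ 1 := fun h => hcon (hsplit N N' hN h)
  have h3 : len A N' ≠ 1 := fun h => hcon (hsplit N' N hN.symm h)
  have h4 : len A ((U × U') ⧸ W) = 3 := hE
  have h5 : len A N + len A N' = 3 := by rw [← h4]; exact h1.symm
  rcases (show len A N = 0 ∨ len A N' = 0 by omega) with h | h
  · exact Or.inl (len_submodule_eq_zero_iff.1 h)
  · right
    have := hN.sup_eq_top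
    rwa [len_submodule_eq_zero_iff.1 h, sup_bot_eq] at this

end Amalgam

section Link

variable {A : Type} [Ring A]

/-- `Q'` is linked to `Q` if it is a projective cover of the maximal submodule of the uniserial
module `Q`. -/
def IsLink (Q' Q : ModuleCat.{0} A) : Prop :=
  ∃ g : Q' →ₗ[A] Q, IsSmallSubmodule A (LinearMap.ker g) ∧
    len A (LinearMap.range g) = len A Q - 1

theorem ne_top_of_isSmallSubmodule {M : Type} [AddCommGroup M] [Module A M] [Nontrivial M]
    {K : Submodule A M} (h : IsSmallSubmodule A K) : K ≠ ⊤ := fun hK =>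
  bot_ne_top (h ⊥ (by rw [hK, top_sup_eq]))

theorem isSmallSubmodule_ker_rangeRestrict {M N : Type} [AddCommGroup M] [Module A M]
    [AddCommGroup N] [Module A N] {g : M →ₗ[A] N} (h : IsSmallSubmodule A (LinearMap.ker g)) :
    IsSmallSubmodule A (LinearMap.ker g.rangeRestrict) := by
  rwa [LinearMap.ker_rangeRestrict]

theorem exists_isCoatom_of_finite (M : Type) [AddCommGroup M] [Module A M] [Module.Finite A M]
    [Nontrivial M] : ∃ K : Submodule A M, IsCoatom K :=
  (eq_top_or_exists_le_coatom (⊥ : Submodule A M)).elim (fun h => absurd h bot_ne_top)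
    fun ⟨K, hK, _⟩ => ⟨K, hK⟩

variable [IsArtinianRing A]

theorem exists_isLink (hA : IsNakayamaRing A) {Q : ModuleCat.{0} A} (hQ : UniserialProjective Q) :
    ∃ Q', UniserialProjective Q' ∧ IsLink Q' Q := by
  have := hQ.finite
  obtain ⟨K, hK⟩ : ∃ K : Submodule A Q, len A K = len A Q - 1 := by
    rcases subsingleton_or_nontrivial Q with hsub | hnt
    · refine ⟨⊥, ?_⟩
      rw [len_submodule_eq_zero_iff.2 rfl, len_eq_zero_iff.2 hsub]
    · obtain ⟨K, hK⟩ := exists_isCoatom_of_finite (A := A) Q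
      have h1 := len_quotient_add K
      rw [len_eq_one_of_isCoatom hK] at h1
      exact ⟨K, by omega⟩
  obtain ⟨P, f, hP, hf, hs⟩ := exists_uniserialProjective_cover hA
    (hQ.uniserial.of_injective K.injective_subtype)
  refine ⟨P, hP, K.subtype ∘ₗ f, ?_, ?_⟩
  · rwa [LinearMap.ker_comp_of_ker_eq_bot _ K.ker_subtype]
  · rw [LinearMap.range_comp, LinearMap.range_eq_top.2 hf, Submodule.map_top,
      Submodule.range_subtype, hK]

theorem IsLink.nonempty_linearEquiv {Q Q' R R' : ModuleCat.{0} A} (h : IsLink Q' Q)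
    (h' : IsLink R' R) (hR : UniserialProjective R) (hQ' : UniserialProjective Q')
    (hR' : UniserialProjective R') (e : Q ≃ₗ[A] R) : Nonempty (Q' ≃ₗ[A] R') := by
  obtain ⟨g, hg, hgl⟩ := h
  obtain ⟨g', hg', hgl'⟩ := h'
  have := hR.finite
  have := hQ'.projective
  have := hR'.projective
  have hmap : (LinearMap.range g).map e.toLinearMap = LinearMap.range g' := by
    refine hR.uniserial.eq_of_len_eq ?_
    rw [len_map_of_injective e.injective, hgl, hgl', len_congr e]
  obtain ⟨φ, -⟩ := exists_linearEquiv_of_covers g.surjective_rangeRestrict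
    g'.surjective_rangeRestrict (isSmallSubmodule_ker_rangeRestrict hg)
    (isSmallSubmodule_ker_rangeRestrict hg') (e.ofSubmodules _ _ hmap)
  exact ⟨φ⟩

/-- The quotient of `P` by the image of the maximal submodule of `P₁` under a link has length two,
and its socle is the top of `P₁`. -/
theorem socle_of_link {P P₁ : ModuleCat.{0} A} (hP : UniserialProjective P)
    (hP₁ : UniserialProjective P₁) [Nontrivial P₁] {g : P₁ →ₗ[A] P}
    (hg : IsSmallSubmodule A (LinearMap.ker g)) (hl : len A (LinearMap.range g) = len A P - 1)
    {K : Submodule A P₁} (hK : IsCoatom K) :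
    len A (P ⧸ K.map g) = 2 ∧ ∃ i : (P₁ ⧸ K) →ₗ[A] P ⧸ K.map g, Injective i := by
  have := hP.finite
  have := hP₁.finite
  have hK1 := len_quotient_add K
  rw [len_eq_one_of_isCoatom hK] at hK1
  have hker : LinearMap.ker g ≤ K := by
    rcases hP₁.uniserial (LinearMap.ker g) K with h | h
    · exact h
    · exact (hK.le_iff.1 h).elim (fun h => absurd h (ne_top_of_isSmallSubmodule hg)) fun h => h.le
  have h1 := len_map_add_ker g hker
  have h2 := len_range_add_ker g
  have h3 := len_quotient_add (K.map g)
  have h4 := len_mono hker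
  refine ⟨by omega, K.mapQ (K.map g) g (Submodule.le_comap_map g K), ?_⟩
  rw [← LinearMap.ker_eq_bot, Submodule.ker_mapQ, Submodule.comap_map_eq,
    sup_eq_left.2 hker, Submodule.mkQ_map_self]

/-- Over a Nakayama ring, a nonzero module is linked to at most one uniserial projective. -/
theorem IsLink.nonempty_linearEquiv_of_source (hA : IsNakayamaRing A)
    {P P' P₁ P₁' : ModuleCat.{0} A} (hP : UniserialProjective P) (hP' : UniserialProjective P')
    (hP₁ : UniserialProjective P₁) [Nontrivial P₁] (h : IsLink P₁ P) (h' : IsLink P₁' P')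
    (e : P₁ ≃ₗ[A] P₁') :
    Nonempty (P ≃ₗ[A] P') := by
  obtain ⟨g, hg, hl⟩ := h
  obtain ⟨g', hg', hl'⟩ := h'
  have := hP.finite
  have := hP'.finite
  have := hP₁.finite
  have := hP.projective
  have := hP'.projective
  have hl₁ : len A (LinearMap.range (g' ∘ₗ e.toLinearMap)) = len A P' - 1 := by
    rwa [LinearMap.range_comp_of_range_eq_top _ e.range]
  have hg₁ : IsSmallSubmodule A (LinearMap.ker (g' ∘ₗ e.toLinearMap)) := by
    have hk := hP₁.uniserial.isSmallSubmodule (K := LinearMap.ker (g' ∘ₗ e.toLinearMap))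
    refine hk fun htop => ?_
    have := e.symm.toEquiv.nontrivial
    refine ne_top_of_isSmallSubmodule hg' (eq_top_iff.2 fun x _ => ?_)
    have hx : e.symm x ∈ LinearMap.ker (g' ∘ₗ e.toLinearMap) := htop ▸ Submodule.mem_top
    simpa using hx
  obtain ⟨K, hK⟩ := exists_isCoatom_of_finite (A := A) P₁
  obtain ⟨hU, i, hi⟩ := socle_of_link hP hP₁ hg hl hK
  obtain ⟨hU', i', hi'⟩ := socle_of_link hP' hP₁ hg₁ hl₁ hK
  obtain ⟨φ⟩ := nonempty_linearEquiv_of_common_socle hA hi hi' (len_eq_one_of_isCoatom hK) hU hU'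
    (hP.uniserial.of_surjective (Submodule.mkQ_surjective _))
    (hP'.uniserial.of_surjective (Submodule.mkQ_surjective _))
  have hsmall : ∀ {R : ModuleCat.{0} A} (_ : UniserialProjective R) (L : Submodule A R),
      len A (R ⧸ L) = 2 → IsSmallSubmodule A (LinearMap.ker L.mkQ) := by
    intro R hR L hL
    have := hR.finite
    refine hR.uniserial.isSmallSubmodule fun htop => ?_
    rw [Submodule.ker_mkQ] at htop
    have h1 := len_quotient_add L
    rw [htop, len_top, ← htop] at h1
    omega
  obtain ⟨ψ, -⟩ := exists_linearEquiv_of_covers (Submodule.mkQ_surjective _)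
    (Submodule.mkQ_surjective _) (hsmall hP _ hU) (hsmall hP' _ hU') φ
  exact ⟨ψ⟩

end Link

section Pigeonhole

variable {A : Type} [Ring A]

/-- If a map onto a simple module vanishes on the intersection of the kernels of finitely many maps
onto simple modules, then its target is isomorphic to one of the targets of those. -/
theorem exists_linearEquiv_of_iInf_ker_le {M T : Type} [AddCommGroup M] [Module A M]
    [AddCommGroup T] [Module A T] [IsSimpleModule A T] {g : M →ₗ[A] T} (hg : Surjective g)
    (S : ℕ → ModuleCat.{0} A) (hS : ∀ i, IsSimpleModule A (S i)) (f : ∀ i, M →ₗ[A] S i) (k : ℕ)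
    (h : ⨅ i < k, LinearMap.ker (f i) ≤ LinearMap.ker g) : ∃ i < k, Nonempty (S i ≃ₗ[A] T) := by
  induction k with
  | zero =>
    have := IsSimpleModule.nontrivial A T
    simp only [not_lt_zero, iInf_false, iInf_top, top_le_iff] at h
    obtain ⟨y, hy⟩ := exists_ne (0 : T)
    obtain ⟨x, rfl⟩ := hg y
    exact absurd (LinearMap.mem_ker.1 (h ▸ Submodule.mem_top)) hy
  | succ k ih =>
    by_cases hk : ⨅ i < k, LinearMap.ker (f i) ≤ LinearMap.ker g
    · obtain ⟨i, hi, e⟩ := ih hk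
      exact ⟨i, hi.trans (Nat.lt_succ_self k), e⟩
    refine ⟨k, Nat.lt_succ_self k, ?_⟩
    set I : Submodule A M := ⨅ i < k, LinearMap.ker (f i) with hI
    have hIk : ∀ x ∈ I, f k x = 0 → g x = 0 := by
      intro x hx hfx
      refine h ?_
      rw [Nat.iInf_lt_succ]
      exact ⟨hx, hfx⟩
    let f' : I →ₗ[A] S k := f k ∘ₗ I.subtype
    let g' : I →ₗ[A] T := g ∘ₗ I.subtype
    have hg0 : g' ≠ 0 := fun h0 => hk fun x hx => LinearMap.congr_fun h0 ⟨x, hx⟩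
    have hf0 : f' ≠ 0 := fun h0 => hg0 (LinearMap.ext fun x =>
      hIk x x.2 (LinearMap.congr_fun h0 x))
    have hfs : Surjective f' := LinearMap.surjective_of_ne_zero hf0
    have hgs : Surjective g' := LinearMap.surjective_of_ne_zero hg0
    have hcoatom : IsCoatom (LinearMap.ker f') := isSimpleModule_iff_isCoatom.1
      ((f'.quotKerEquivOfSurjective hfs).isSimpleModule_iff.2 (hS k))
    have heq : LinearMap.ker g' = LinearMap.ker f' := by
      refine (hcoatom.le_iff.1 fun x hx => hIk x x.2 hx).resolve_left fun htop => ?_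
      exact hg0 (LinearMap.ker_eq_top.1 htop)
    exact ⟨(f'.quotKerEquivOfSurjective hfs).symm.trans
      ((Submodule.quotEquivOfEq _ _ heq.symm).trans (g'.quotKerEquivOfSurjective hgs))⟩

theorem exists_lt_nonempty_linearEquiv [IsArtinianRing A] (Q : ℕ → ModuleCat.{0} A)
    (hQ : ∀ i, UniserialProjective (Q i)) (hnt : ∀ i, Nontrivial (Q i)) :
    ∃ i j, i < j ∧ Nonempty (Q i ≃ₗ[A] Q j) := by
  have := fun i => (hQ i).finite
  have := fun i => (hQ i).projective
  choose K hK using fun i => exists_isCoatom_of_finite (A := A) (Q i)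
  choose p hp using fun i => (hQ i).uniserial.exists_surjective
  let S : ℕ → ModuleCat.{0} A := fun i => ModuleCat.of A (Q i ⧸ K i)
  have hS : ∀ i, IsSimpleModule A (S i) := fun i => isSimpleModule_iff_isCoatom.2 (hK i)
  let f : ∀ i, A →ₗ[A] S i := fun i => (K i).mkQ ∘ₗ p i
  let I : ℕ →o (Submodule A A)ᵒᵈ :=
    ⟨fun k => OrderDual.toDual (⨅ i < k, LinearMap.ker (f i)), fun a b hab =>
      OrderDual.toDual_le_toDual.2 (biInf_mono fun i hi => hi.trans_le hab)⟩
  obtain ⟨j, hj⟩ := IsArtinian.monotone_stabilizes I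
  have hjj : ⨅ i < j, LinearMap.ker (f i) = ⨅ i < j + 1, LinearMap.ker (f i) :=
    OrderDual.toDual.injective (hj (j + 1) j.le_succ)
  have hfs : Surjective (f j) := ((K j).mkQ_surjective).comp (hp j)
  have := hS j
  obtain ⟨i, hi, ⟨e⟩⟩ := exists_linearEquiv_of_iInf_ker_le hfs S hS f j (by
    rw [hjj, Nat.iInf_lt_succ]
    exact inf_le_right)
  have hsmall : ∀ i, IsSmallSubmodule A (LinearMap.ker (K i).mkQ) := fun i =>
    (hQ i).uniserial.isSmallSubmodule (by rw [Submodule.ker_mkQ]; exact (hK i).1)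
  obtain ⟨φ, -⟩ := exists_linearEquiv_of_covers (K i).mkQ_surjective (K j).mkQ_surjective
    (hsmall i) (hsmall j) e
  exact ⟨i, j, hi, ⟨φ⟩⟩

end Pigeonhole

section Dynamics

/-- The sequence `a, b, f a, f b, f (f a), …`. -/
def interleave (f : ℕ → ℕ) (a b : ℕ) : ℕ → ℕ
  | 0 => a
  | 1 => b
  | k + 2 => f (interleave f a b k)

variable {f : ℕ → ℕ} {a b : ℕ}

theorem interleave_two_mul (k : ℕ) : interleave f a b (2 * k) = f^[k] a := by
  induction k with
  | zero => rfl
  | succ k ih => rw [iterate_succ_apply', ← ih]; rfl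

theorem interleave_two_mul_add_one (k : ℕ) : interleave f a b (2 * k + 1) = f^[k] b := by
  induction k with
  | zero => rfl
  | succ k ih => rw [iterate_succ_apply', ← ih]; rfl

theorem interleave_lt_of_even {i m : ℕ} (h : ∀ k ≤ m, f^[k] a < f^[k] b)
    (h' : ∀ k < m, f^[k] b < f^[k + 1] a) (hi : i ≤ 2 * m) :
    interleave f a b i < interleave f a b (i + 1) := by
  obtain ⟨k, rfl | rfl⟩ := i.even_or_odd'
  · rw [interleave_two_mul, interleave_two_mul_add_one]
    exact h k (by omega)
  · rw [interleave_two_mul_add_one, show 2 * k + 1 + 1 = 2 * (k + 1) by ring, interleave_two_mul]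
    exact h' k (by omega)

theorem iterate_add_mul_of_periodic {n : ℕ} (hper : ∀ j, f (j + n) = f j + n) (k j t : ℕ) :
    f^[k] (j + n * t) = f^[k] j + n * t := by
  have hmul : ∀ t j, f (j + n * t) = f j + n * t := by
    intro t
    induction t with
    | zero => simp
    | succ t ih => intro j; rw [Nat.mul_succ, ← add_assoc, hper, ih, add_assoc]
  induction k generalizing j with
  | zero => rfl
  | succ k ih => rw [iterate_succ_apply, hmul, ih, iterate_succ_apply]

/-- For a monotone map that commutes with a translation, some translate of the orbit of `1` meets an
earlier orbit; take the first time at which this can happen. -/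
theorem exists_orbit_coincidence {n : ℕ} (hf : Monotone f) (hn : 0 < n)
    (hper : ∀ j, f (j + n) = f j + n) (h01 : ∀ k, f^[k] 0 < f^[k] 1)
    (h10 : ∀ k, f^[k] 1 < f^[k + 1] 0) :
    ∃ m t a, f^[m] (n * t + 1) = f^[m + 1] a ∧ (∀ k ≤ m, f^[k] a < f^[k] (n * t)) ∧
      (∀ k ≤ m, f^[k] (n * t) < f^[k + 1] a) ∧ ∀ k < m, f^[k] (n * t + 1) < f^[k + 1] a := by
  have htrans := iterate_add_mul_of_periodic hper
  have hmono : StrictMono fun k => f^[k] 1 :=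
    strictMono_nat_of_lt_succ fun k => (h10 k).trans (h01 (k + 1))
  have hex : ∃ m t a, f^[m] (n * t + 1) = f^[m + 1] a := by
    obtain ⟨p, q, hpq, hmod⟩ : ∃ p q, p < q ∧ f^[p] 1 ≡ f^[q] 1 [MOD n] := by
      have : NeZero n := ⟨hn.ne'⟩
      obtain ⟨p, q, hne, h⟩ :=
        Finite.exists_ne_map_eq_of_infinite fun k => ((f^[k] 1 : ℕ) : ZMod n)
      rcases hne.lt_or_gt with hlt | hlt
      · exact ⟨p, q, hlt, (ZMod.natCast_eq_natCast_iff _ _ _).1 h⟩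
      · exact ⟨q, p, hlt, (ZMod.natCast_eq_natCast_iff _ _ _).1 h.symm⟩
    have hle : f^[p] 1 ≤ f^[q] 1 := (hmono hpq).le
    obtain ⟨t, ht⟩ := (Nat.modEq_iff_dvd' hle).1 hmod
    refine ⟨p, t, f^[q - p - 1] 1, ?_⟩
    rw [← iterate_add_apply, show p + 1 + (q - p - 1) = q by omega, add_comm, htrans, ← ht,
      Nat.add_sub_cancel' hle]
  obtain ⟨t, a, hta⟩ := Nat.find_spec hex
  have hmin := fun k hk => Nat.find_min (m := k) hex hk
  set m := Nat.find hex
  have hlt : ∀ {k x y}, k ≤ m + 1 → f^[m + 1] x < f^[m + 1] y → f^[k] x < f^[k] y := by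
    intro k x y hk hxy
    by_contra! hle
    have := (hf.iterate (m + 1 - k)) hle
    rw [← iterate_add_apply, ← iterate_add_apply, Nat.sub_add_cancel hk] at this
    omega
  have hlt' : ∀ {k}, k ≤ m → f^[k] (n * t) < f^[k + 1] a := by
    intro k hk
    by_contra! hle
    have h1 := (hf.iterate (m - k)) hle
    rw [← iterate_add_apply, ← iterate_add_apply, show m - k + (k + 1) = m + 1 by omega,
      Nat.sub_add_cancel hk, ← hta, add_comm, htrans] at h1
    have h2 := htrans m 0 t
    rw [zero_add] at h2
    have := h01 m
    omega
  have hstep : n * t + 1 ≤ f a := hlt' (Nat.zero_le m)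
  refine ⟨m, t, a, hta, fun k hk => hlt (by omega) ?_, fun k hk => hlt' hk, fun k hk => ?_⟩
  · have h1 := htrans (m + 1) 0 t
    have h2 := h10 m
    rw [zero_add] at h1
    rw [← hta, h1, add_comm, htrans]
    omega
  · have := (hf.iterate k) hstep
    rw [← iterate_succ_apply] at this
    exact this.lt_of_ne fun h => hmin k hk ⟨t, a, h⟩

end Dynamics

section Chain

variable {A : Type} [Ring A]

theorem projDim_le_finDim {M : ModuleCat.{0} A} [Module.Finite A M] (h : projDim A M ≠ ⊤) :
    projDim A M ≤ finDim A :=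
  le_sSup ⟨h, M, inferInstance, rfl⟩

/-- A sequence of uniserial projectives in which every term is linked to the preceding one. -/
structure IsChain (Q : ℕ → ModuleCat.{0} A) : Prop where
  uniserialProjective : ∀ j, UniserialProjective (Q j)
  isLink : ∀ j, IsLink (Q (j + 1)) (Q j)

/-- The position in the chain just after the composition factors of `Q j`. -/
def chainEnd (Q : ℕ → ModuleCat.{0} A) (j : ℕ) : ℕ := j + len A (Q j)

/-- `M` is the quotient of `Q a` with composition factors at the positions `a, …, b - 1`. -/
def IsSegment (Q : ℕ → ModuleCat.{0} A) (M : ModuleCat.{0} A) (a b : ℕ) : Prop :=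
  ∃ p : Q a →ₗ[A] M, Surjective p ∧ a + len A M = b

variable {Q : ℕ → ModuleCat.{0} A}

theorem IsSegment.finite (hQ : IsChain Q) {M : ModuleCat.{0} A} {a b : ℕ}
    (h : IsSegment Q M a b) : Module.Finite A M := by
  obtain ⟨p, hp, -⟩ := h
  have := (hQ.uniserialProjective a).finite
  exact Module.Finite.of_surjective p hp

variable [IsArtinianRing A]

theorem exists_isChain (hA : IsNakayamaRing A) {P : ModuleCat.{0} A}
    (hP : UniserialProjective P) : ∃ Q : ℕ → ModuleCat.{0} A, IsChain Q ∧ Q 0 = P := by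
  choose next hnext using fun R : {R : ModuleCat.{0} A // UniserialProjective R} =>
    exists_isLink hA R.2
  let q : ℕ → {R : ModuleCat.{0} A // UniserialProjective R} := fun j =>
    Nat.rec ⟨P, hP⟩ (fun _ R => ⟨next R, (hnext R).1⟩) j
  exact ⟨fun j => (q j).1, ⟨fun j => (q j).2, fun j => (hnext (q j)).2⟩, rfl⟩

theorem IsChain.monotone_chainEnd (hQ : IsChain Q) : Monotone (chainEnd Q) := by
  refine monotone_nat_of_le_succ fun j => ?_
  obtain ⟨g, -, hg⟩ := hQ.isLink j
  have := (hQ.uniserialProjective (j + 1)).finite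
  have h1 := len_range_add_ker g
  unfold chainEnd
  omega

theorem IsChain.exists_linearMap (hQ : IsChain Q) (a k : ℕ) (hk : k ≤ len A (Q a)) :
    ∃ h : Q (a + k) →ₗ[A] Q a, len A (LinearMap.range h) = len A (Q a) - k := by
  induction k with
  | zero => exact ⟨LinearMap.id, by rw [LinearMap.range_id, len_top, Nat.sub_zero]⟩
  | succ k ih =>
    obtain ⟨h, hh⟩ := ih (by omega)
    obtain ⟨g, -, hg⟩ := hQ.isLink (a + k)
    have := (hQ.uniserialProjective (a + k)).finite
    have h1 := len_range_add_ker h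
    have hle : LinearMap.ker h ≤ LinearMap.range g :=
      (hQ.uniserialProjective (a + k)).uniserial.le_of_len_le (by omega)
    have h2 := len_map_add_ker h hle
    refine ⟨h ∘ₗ g, ?_⟩
    rw [LinearMap.range_comp]
    omega

theorem IsChain.exists_isSegment (hQ : IsChain Q) {a b : ℕ} (hab : a ≤ b)
    (hb : b ≤ chainEnd Q a) : ∃ M, IsSegment Q M a b := by
  obtain ⟨k, rfl⟩ := Nat.exists_eq_add_of_le hab
  unfold chainEnd at hb
  obtain ⟨h, hh⟩ := hQ.exists_linearMap a k (by omega)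
  have := (hQ.uniserialProjective a).finite
  refine ⟨ModuleCat.of A (Q a ⧸ LinearMap.range h), Submodule.mkQ _, Submodule.mkQ_surjective _, ?_⟩
  have h1 := len_quotient_add (LinearMap.range h)
  change a + len A (Q a ⧸ LinearMap.range h) = a + k
  omega

theorem IsSegment.nonempty_linearEquiv (hQ : IsChain Q) {M M' : ModuleCat.{0} A} {a b a' s : ℕ}
    (e : Q a ≃ₗ[A] Q a') (hs : a' = a + s) (h : IsSegment Q M a b)
    (h' : IsSegment Q M' a' (b + s)) : Nonempty (M ≃ₗ[A] M') := by
  obtain ⟨p, hp, rfl⟩ := h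
  obtain ⟨p', hp', hl⟩ := h'
  have := (hQ.uniserialProjective a).finite
  have hpe : Surjective (p' ∘ₗ e.toLinearMap) := hp'.comp e.surjective
  have hker : LinearMap.ker p = LinearMap.ker (p' ∘ₗ e.toLinearMap) := by
    refine (hQ.uniserialProjective a).uniserial.eq_of_len_eq ?_
    have h1 := len_add_ker_of_surjective hp
    have h2 := len_add_ker_of_surjective hpe
    omega
  exact ⟨(p.quotKerEquivOfSurjective hp).symm.trans ((Submodule.quotEquivOfEq _ _ hker).trans
    ((p' ∘ₗ e.toLinearMap).quotKerEquivOfSurjective hpe))⟩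

theorem IsSegment.isSmallSubmodule_ker (hQ : IsChain Q) {M : ModuleCat.{0} A} {a : ℕ}
    {p : Q a →ₗ[A] M} (hp : Surjective p) (hM : 0 < len A M) :
    IsSmallSubmodule A (LinearMap.ker p) := by
  have := (hQ.uniserialProjective a).finite
  refine (hQ.uniserialProjective a).uniserial.isSmallSubmodule fun htop => ?_
  have h1 := len_add_ker_of_surjective hp
  rw [htop, len_top] at h1
  omega

theorem IsSegment.exists_isSyzygyOf (hQ : IsChain Q) {M : ModuleCat.{0} A} {a b : ℕ}
    (h : IsSegment Q M a b) (hab : a < b) :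
    ∃ N, IsSyzygyOf A N M ∧ IsSegment Q N b (chainEnd Q a) := by
  obtain ⟨p, hp, rfl⟩ := h
  have hQa := hQ.uniserialProjective a
  have := hQa.finite
  have h1 := len_add_ker_of_surjective hp
  obtain ⟨h, hh⟩ := hQ.exists_linearMap a (len A M) (by omega)
  have hker : LinearMap.range h = LinearMap.ker p := hQa.uniserial.eq_of_len_eq (by omega)
  refine ⟨ModuleCat.of A (LinearMap.range h), ⟨Q a, p, hQa.projective, hQa.finite, hp,
    isSmallSubmodule_ker hQ hp (by omega), ⟨LinearEquiv.ofEq _ _ hker⟩⟩,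
    h.rangeRestrict, h.surjective_rangeRestrict, ?_⟩
  change a + len A M + len A (LinearMap.range h) = a + len A (Q a)
  omega

theorem IsSegment.exists_isNthSyzygyOf (hQ : IsChain Q) {M : ModuleCat.{0} A} {a b : ℕ}
    (h : IsSegment Q M a b) (k : ℕ)
    (hk : ∀ i < k, interleave (chainEnd Q) a b i < interleave (chainEnd Q) a b (i + 1)) :
    ∃ N, IsNthSyzygyOf A k N M ∧
      IsSegment Q N (interleave (chainEnd Q) a b k) (interleave (chainEnd Q) a b (k + 1)) := by
  induction k with
  | zero => exact ⟨M, ⟨LinearEquiv.refl A M⟩, h⟩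
  | succ k ih =>
    obtain ⟨K, hK, hseg⟩ := ih fun i hi => hk i (by omega)
    obtain ⟨N, hN, hN'⟩ := hseg.exists_isSyzygyOf hQ (hk k k.lt_succ_self)
    exact ⟨N, ⟨K, hK, hN⟩, hN'⟩

theorem IsSegment.projective (hQ : IsChain Q) {M : ModuleCat.{0} A} {a : ℕ}
    (h : IsSegment Q M a (chainEnd Q a)) : Module.Projective A M := by
  obtain ⟨p, hp, hl⟩ := h
  have := (hQ.uniserialProjective a).finite
  have := (hQ.uniserialProjective a).projective
  have h1 := len_add_ker_of_surjective hp
  unfold chainEnd at hl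
  have hker : LinearMap.ker p = ⊥ := (len_submodule_eq_zero_iff (A := A)).1 (by omega)
  exact Module.Projective.of_equiv (LinearEquiv.ofBijective p ⟨LinearMap.ker_eq_bot.1 hker, hp⟩)

theorem IsSegment.not_projective (hQ : IsChain Q) {M : ModuleCat.{0} A} {a b : ℕ}
    (h : IsSegment Q M a b) (hab : a < b) (hb : b < chainEnd Q a) : ¬ Module.Projective A M := by
  intro hM
  have := h.finite hQ
  obtain ⟨p, hp, rfl⟩ := h
  have := (hQ.uniserialProjective a).finite
  have := (hQ.uniserialProjective a).projective
  obtain ⟨e⟩ := exists_ker_linearEquiv_of_covers hp (f' := LinearMap.id) surjective_id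
    (isSmallSubmodule_ker hQ hp (by omega)) (fun K hK => by simpa using hK)
    (LinearEquiv.refl A M)
  have h1 := len_add_ker_of_surjective hp
  rw [len_congr e, len_submodule_eq_zero_iff.2 LinearMap.ker_id] at h1
  unfold chainEnd at hb
  omega

theorem IsChain.nonempty_linearEquiv_add (hQ : IsChain Q) {n : ℕ}
    (h : Nonempty (Q 0 ≃ₗ[A] Q n)) (j t : ℕ) : Nonempty (Q j ≃ₗ[A] Q (j + n * t)) := by
  have hone : ∀ j, Nonempty (Q j ≃ₗ[A] Q (j + n)) := by
    intro j
    induction j with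
    | zero => rwa [zero_add]
    | succ j ih =>
      obtain ⟨e⟩ := ih
      rw [show j + 1 + n = j + n + 1 by ring]
      exact (hQ.isLink j).nonempty_linearEquiv (hQ.isLink _) (hQ.uniserialProjective _)
        (hQ.uniserialProjective _) (hQ.uniserialProjective _) e
  induction t with
  | zero => exact ⟨LinearEquiv.refl A _⟩
  | succ t ih =>
    obtain ⟨e⟩ := ih
    obtain ⟨e'⟩ := hone (j + n * t)
    rw [Nat.mul_succ, ← add_assoc]
    exact ⟨e.trans e'⟩

theorem IsChain.exists_period (hA : IsNakayamaRing A) (hQ : IsChain Q)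
    (hnt : ∀ i, Nontrivial (Q i)) : ∃ n, 0 < n ∧ Nonempty (Q 0 ≃ₗ[A] Q n) := by
  obtain ⟨i, j, hij, h⟩ := exists_lt_nonempty_linearEquiv Q hQ.uniserialProjective hnt
  obtain ⟨n, rfl⟩ := Nat.exists_eq_add_of_le hij.le
  refine ⟨n, by omega, ?_⟩
  clear hij
  induction i with
  | zero => rwa [zero_add] at h
  | succ i ih =>
    obtain ⟨e⟩ := h
    refine ih ?_
    rw [show i + 1 + n = i + n + 1 by ring] at e
    exact (hQ.isLink i).nonempty_linearEquiv_of_source hA (hQ.uniserialProjective i)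
      (hQ.uniserialProjective _) (hQ.uniserialProjective _) (hQ.isLink _) e

theorem IsSegment.interleave_lt (hQ : IsChain Q) {M : ModuleCat.{0} A} {a b : ℕ}
    (h : IsSegment Q M a b) (hM : projDim A M = ⊤) (k : ℕ) :
    interleave (chainEnd Q) a b k < interleave (chainEnd Q) a b (k + 1) := by
  induction k using Nat.strong_induction_on with
  | _ k ih =>
    obtain ⟨N, hN, hseg⟩ := h.exists_isNthSyzygyOf hQ k ih
    have := hseg.finite hQ
    obtain ⟨p, -, hl⟩ := hseg
    by_contra hlt
    have hsub : Subsingleton N := (len_eq_zero_iff (A := A)).1 (by omega)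
    have hle : projDim A M ≤ k := natInf_le ⟨N, hN,
      have := Module.Free.of_subsingleton A N; Module.Projective.of_free⟩
    rw [hM] at hle
    exact ENat.natCast_ne_top k (top_le_iff.1 hle)

theorem IsChain.len_pos (hQ : IsChain Q) (h : ∀ k, interleave (chainEnd Q) 0 1 k <
    interleave (chainEnd Q) 0 1 (k + 1)) (j : ℕ) : 0 < len A (Q j) := by
  by_contra hj
  have hfix : chainEnd Q j = j := by unfold chainEnd; omega
  have hmono : StrictMono (interleave (chainEnd Q) 0 1) := strictMono_nat_of_lt_succ h
  have hj0 : 1 ≤ j := by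
    rcases j.eq_zero_or_pos with rfl | hpos
    · have := h 1
      change 1 < chainEnd Q 0 at this
      omega
    · exact hpos
  have hbound : ∀ k, interleave (chainEnd Q) 0 1 k ≤ j := by
    intro k
    induction k using Nat.twoStepInduction with
    | zero => exact Nat.zero_le j
    | one => exact hj0
    | more k ih _ => exact (hQ.monotone_chainEnd ih).trans hfix.le
  have := hmono.le_apply (x := j + 1)
  have := hbound (j + 1)
  omega

theorem projDim_eq_of_isSegment (hQ : IsChain Q) {M : ModuleCat.{0} A} {a b m : ℕ}
    (h : IsSegment Q M a b) (hlt : ∀ k ≤ m, (chainEnd Q)^[k] a < (chainEnd Q)^[k] b)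
    (hlt' : ∀ k < m, (chainEnd Q)^[k] b < (chainEnd Q)^[k + 1] a)
    (heq : (chainEnd Q)^[m] b = (chainEnd Q)^[m + 1] a) : projDim A M = (2 * m : ℕ) := by
  have hint : ∀ i ≤ 2 * m, interleave (chainEnd Q) a b i < interleave (chainEnd Q) a b (i + 1) :=
    fun i hi => interleave_lt_of_even hlt hlt' hi
  refine le_antisymm (natInf_le ?_) (le_sInf ?_)
  · obtain ⟨N, hN, hseg⟩ := h.exists_isNthSyzygyOf hQ (2 * m) fun i hi => hint i hi.le
    rw [interleave_two_mul, interleave_two_mul_add_one, heq, iterate_succ_apply'] at hseg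
    exact ⟨N, hN, hseg.projective hQ⟩
  · rintro _ ⟨i, ⟨N, hN, hproj⟩, rfl⟩
    by_contra! hi
    have hi' : i < 2 * m := by exact_mod_cast hi
    obtain ⟨N', hN', hseg⟩ := h.exists_isNthSyzygyOf hQ i fun i' _ => hint i' (by omega)
    obtain ⟨e⟩ := nonempty_linearEquiv_of_isNthSyzygyOf hN hN'
    exact hseg.not_projective hQ (hint i hi'.le) (hint (i + 1) hi') (Module.Projective.of_equiv e)

theorem delMod_le_finDim (hA : IsNakayamaRing A) (S : ModuleCat.{0} A) [IsSimpleModule A S] :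
    delMod A S ≤ finDim A := by
  by_cases htop : projDim A S ≠ ⊤
  · exact (delMod_le_projDim hA S).trans (projDim_le_finDim htop)
  rw [not_not] at htop
  obtain ⟨P, p, hP, hp, -⟩ := exists_uniserialProjective_cover hA (uniserial_of_isSimpleModule S)
  obtain ⟨Q, hQ, rfl⟩ := exists_isChain hA hP
  have hS : IsSegment Q S 0 1 := ⟨p, hp, by rw [len_eq_one]⟩
  have hint := hS.interleave_lt hQ htop
  have hfin := fun i => (hQ.uniserialProjective i).finite
  obtain ⟨n, hn, hper⟩ := hQ.exists_period hA fun i => len_pos_iff.1 (hQ.len_pos hint i)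
  have hshift := hQ.nonempty_linearEquiv_add hper
  have hend : ∀ j, chainEnd Q (j + n) = chainEnd Q j + n := by
    intro j
    obtain ⟨e⟩ := hshift j 1
    have := len_congr e
    rw [mul_one] at this
    unfold chainEnd
    omega
  obtain ⟨m, t, a, heq, h1, h2, h3⟩ := exists_orbit_coincidence hQ.monotone_chainEnd hn hend
    (fun k => by
      have := hint (2 * k)
      rwa [interleave_two_mul, interleave_two_mul_add_one] at this)
    (fun k => by
      have := hint (2 * k + 1)
      rwa [interleave_two_mul_add_one, show 2 * k + 1 + 1 = 2 * (k + 1) by ring,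
        interleave_two_mul] at this)
  have ha : a < n * t := h1 0 m.zero_le
  have hb : n * t < chainEnd Q a := h2 0 m.zero_le
  obtain ⟨M, hM⟩ := hQ.exists_isSegment (show a ≤ n * t + 1 by omega) hb
  obtain ⟨M', hM'⟩ := hQ.exists_isSegment ha.le hb.le
  have := hM.finite hQ
  have hpd := projDim_eq_of_isSegment hQ hM
    (fun k hk => (h1 k hk).trans_le (hQ.monotone_chainEnd.iterate k (Nat.le_succ _))) h3 heq
  refine le_trans (natInf_le ?_) (hpd ▸ projDim_le_finDim (hpd ▸ ENat.natCast_ne_top _))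
  obtain ⟨N, hN, hsN⟩ := hS.exists_isNthSyzygyOf hQ (2 * m) fun i _ => hint i
  obtain ⟨N', hN', hsN'⟩ := hM'.exists_isNthSyzygyOf hQ (2 * m + 1) fun i hi =>
    interleave_lt_of_even h1 (fun k hk => h2 k hk.le) (by omega)
  rw [interleave_two_mul, interleave_two_mul_add_one] at hsN
  rw [interleave_two_mul_add_one, show 2 * m + 1 + 1 = 2 * (m + 1) by ring, interleave_two_mul,
    ← heq, add_comm (n * t), iterate_add_mul_of_periodic hend] at hsN'
  have hnt := iterate_add_mul_of_periodic hend m 0 t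
  rw [zero_add] at hnt
  obtain ⟨e⟩ := hshift ((chainEnd Q)^[m] 0) t
  rw [← hnt] at e
  obtain ⟨φ⟩ := hsN.nonempty_linearEquiv hQ e hnt hsN'
  exact ⟨M', N, N', hM'.finite hQ, hN, hN', isDirectSummandOf_prod_of_linearEquiv φ⟩

theorem delAlg_le_finDim (hA : IsNakayamaRing A) : delAlg A ≤ finDim A := by
  refine sSup_le ?_
  rintro _ ⟨S, hS, rfl⟩
  exact delMod_le_finDim hA S

end Chain

end Nakayama

/-- Ringel.  For a Nakayama algebra `Λ`, the finitistic dimension of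
`Λ`, the finitistic dimension of `Λᵒᵖ`, the delooping level of `Λ` and the delooping
level of `Λᵒᵖ` all coincide. -/
theorem findim_findim_op_del_del_op_all_equal
    (A : Type) [Ring A] (hA : IsNakayamaAlgebra A) :
    finDim A = finDim Aᵐᵒᵖ ∧ finDim A = delAlg A ∧ finDim A = delAlg Aᵐᵒᵖ := by
  have := hA.1.1
  have := hA.2.1
  have h1 : finDim Aᵐᵒᵖ ≤ delAlg A := Nakayama.finDim_le_delAlg (RingEquiv.refl Aᵐᵒᵖ)
  have h2 : finDim A ≤ delAlg Aᵐᵒᵖ := Nakayama.finDim_le_delAlg (RingEquiv.opOp A)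
  have h3 : delAlg A ≤ finDim A := Nakayama.delAlg_le_finDim hA.1
  have h4 : delAlg Aᵐᵒᵖ ≤ finDim Aᵐᵒᵖ := Nakayama.delAlg_le_finDim hA.2
  exact ⟨le_antisymm (h2.trans h4) (h1.trans h3), le_antisymm (h2.trans (h4.trans h1)) h3,
    le_antisymm h2 (h4.trans (h1.trans h3))⟩

end
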